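/- For each n ≥ 1 let 𝓘_n denote the set of pairs (F, J) where F is an acyclic simple graph (forest) on the vertex set Fin n and J is a maximal independent set of F, let i_n = |𝓘_n|, let E_n = (Σ_{(F,J) ∈ 𝓘_n} |J|) / i_n, and let V_n = (Σ_{(F,J) ∈ 𝓘_n} |J|²) / i_n − E_n². Then the size of a uniformly random element of 𝓘_n satisfies a central limit theorem: for every real number x, the proportion |{(F,J) ∈ 𝓘_n : |J| ≤ E_n + x·√V_n}| / i_n converges, as n → ∞, to Φ(x) = (1/√(2π)) ∫_{−∞}^{x} e^{−t²/2} dt, the standard Gaussian cumulative distribution function. -/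

import Mathlib

open Filter Topology MeasureTheory

/-- `J` is an independent set of the simple graph `G`. -/
def IsIndepSet {V : Type*} (G : SimpleGraph V) (J : Set V) : Prop :=
  ∀ ⦃u v : V⦄, u ∈ J → v ∈ J → ¬ G.Adj u v

/-- `J` is a maximal independent set of `G`. -/
def IsMaximalIndepSet {V : Type*} (G : SimpleGraph V) (J : Set V) : Prop :=
  IsIndepSet G J ∧ ∀ J' : Set V, IsIndepSet G J' → ¬ J ⊂ J'

/-- The pairs `(F, J)` where `F` is a forest (acyclic simple graph) on `Fin n`
and `J` is a maximal independent set of `F`. -/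
def MISpace (n : ℕ) :=
  {p : SimpleGraph (Fin n) × Set (Fin n) // p.1.IsAcyclic ∧ IsMaximalIndepSet p.1 p.2}

/-- `iN n` is the number of pairs `(F, J)` where `F` is a forest on `Fin n`
and `J` is a maximal independent set of `F`. -/
noncomputable def iN (n : ℕ) : ℕ := Nat.card (MISpace n)

/-- The expected size of a uniformly random maximal independent set–forest
pair on `n` vertices: the arithmetic mean of `|J|` over all pairs `(F, J)`. -/
noncomputable def En (n : ℕ) : ℝ :=
  (∑ᶠ p : MISpace n, (p.val.2.ncard : ℝ)) / (iN n : ℝ)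


/-- The variance of the size of a uniformly random maximal independent
set–forest pair on `n` vertices. -/
noncomputable def Vn (n : ℕ) : ℝ :=
  (∑ᶠ p : MISpace n, (p.val.2.ncard : ℝ) ^ 2) / (iN n : ℝ) - (En n) ^ 2

namespace ForestMIS

section Graphs

variable {V : Type*} {G G₁ G₂ : SimpleGraph V} {S S₁ S₂ : Finset V} {v w r c : V}

/-- All edges of `G` lie inside `S`. -/
def SupportedOn (G : SimpleGraph V) (S : Finset V) : Prop :=
  ∀ ⦃v w : V⦄, G.Adj v w → v ∈ S

/-- `G` is a tree on the vertex set `S` (and has no edge outside `S`). -/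
def IsTreeOn (G : SimpleGraph V) (S : Finset V) : Prop :=
  G.IsAcyclic ∧ SupportedOn G S ∧ ∀ v ∈ S, ∀ w ∈ S, G.Reachable v w

/-- `G` is a forest on the vertex set `S` (and has no edge outside `S`). -/
def IsForestOn (G : SimpleGraph V) (S : Finset V) : Prop :=
  G.IsAcyclic ∧ SupportedOn G S

/-- The graph formed by the edges of `G` inside `S`. -/
def restrict (G : SimpleGraph V) (S : Finset V) : SimpleGraph V where
  Adj v w := G.Adj v w ∧ v ∈ S ∧ w ∈ S
  symm := ⟨fun _ _ h => ⟨h.1.symm, h.2.2, h.2.1⟩⟩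
  loopless := ⟨fun v h => G.loopless.irrefl v h.1⟩

/-- The graph formed by the edges of `G` not incident to `r`. -/
def removeVertex (G : SimpleGraph V) (r : V) : SimpleGraph V where
  Adj v w := G.Adj v w ∧ v ≠ r ∧ w ≠ r
  symm := ⟨fun _ _ h => ⟨h.1.symm, h.2.2, h.2.1⟩⟩
  loopless := ⟨fun v h => G.loopless.irrefl v h.1⟩

lemma restrict_adj : (restrict G S).Adj v w ↔ G.Adj v w ∧ v ∈ S ∧ w ∈ S := Iff.rfl

lemma restrict_le (G : SimpleGraph V) (S : Finset V) : restrict G S ≤ G := fun _ _ h => h.1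

lemma supportedOn_restrict (G : SimpleGraph V) (S : Finset V) : SupportedOn (restrict G S) S :=
  fun _ _ h => h.2.1

/-- A property closed under adjacency propagates along reachability. -/
lemma reachable_induction {p : V → Prop} (hp : ∀ x y, p x → G.Adj x y → p y)
    (h : G.Reachable v w) (hv : p v) : p w := by
  rw [SimpleGraph.reachable_iff_reflTransGen] at h
  induction h with
  | refl => exact hv
  | tail _ h ih => exact hp _ _ ih h

lemma not_reachable_removeVertex (hv : v ≠ r) : ¬ (removeVertex G r).Reachable v r := fun h =>
  reachable_induction (p := fun x => x ≠ r) (fun _ _ _ (h : (removeVertex G r).Adj _ _) => h.2.2) h hv rfl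

/-- Reachability in a disjoint union of graphs stays inside one of the parts. -/
lemma reachable_sup_left (h₁ : SupportedOn G₁ S₁) (h₂ : ∀ ⦃v w⦄, G₂.Adj v w → v ∉ S₁)
    (hv : v ∈ S₁) (h : (G₁ ⊔ G₂).Reachable v w) : w ∈ S₁ ∧ G₁.Reachable v w := by
  refine reachable_induction (p := fun w => w ∈ S₁ ∧ G₁.Reachable v w) ?_ h ⟨hv, .refl _⟩
  rintro x y ⟨hx, hvx⟩ (hxy | hxy)
  · exact ⟨h₁ hxy.symm, hvx.trans hxy.reachable⟩
  · exact absurd hx (h₂ hxy)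

lemma isAcyclic_sup (hS : Disjoint S₁ S₂) (h₁ : IsForestOn G₁ S₁) (h₂ : IsForestOn G₂ S₂) :
    (G₁ ⊔ G₂).IsAcyclic := by
  have key : ∀ {H₁ H₂ : SimpleGraph V} {T₁ T₂ : Finset V}, Disjoint T₁ T₂ → IsForestOn H₁ T₁ →
      IsForestOn H₂ T₂ → ∀ v w, H₁.Adj v w → (H₁ ⊔ H₂).IsBridge s(v, w) := by
    intro H₁ H₂ T₁ T₂ hT h₁ h₂ v w hvw
    rw [SimpleGraph.isBridge_iff]
    intro hr
    have hb := SimpleGraph.isAcyclic_iff_forall_adj_isBridge.1 h₁.1 hvw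
    rw [SimpleGraph.isBridge_iff] at hb
    apply hb
    have hd : (H₁ ⊔ H₂).deleteEdges {s(v, w)} =
        H₁.deleteEdges {s(v, w)} ⊔ H₂.deleteEdges {s(v, w)} := by
      ext x y
      simp only [SimpleGraph.deleteEdges_adj, SimpleGraph.sup_adj]
      tauto
    rw [hd] at hr
    refine (reachable_sup_left (S₁ := T₁) ?_ ?_ (h₁.2 hvw) hr).2
    · intro x y hxy
      exact h₁.2 (SimpleGraph.deleteEdges_le _ hxy)
    · intro x y hxy hx
      exact Finset.disjoint_left.1 hT hx (h₂.2 (SimpleGraph.deleteEdges_le _ hxy))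
  rw [SimpleGraph.isAcyclic_iff_forall_adj_isBridge]
  rintro v w (h | h)
  · exact key hS h₁ h₂ v w h
  · rw [sup_comm]
    exact key hS.symm h₂ h₁ v w h

lemma isForestOn_restrict (h : IsForestOn G S) (S₁ : Finset V) :
    IsForestOn (restrict G S₁) S₁ :=
  ⟨h.1.anti (restrict_le _ _), supportedOn_restrict _ _⟩

lemma IsTreeOn.isForestOn (h : IsTreeOn G S) : IsForestOn G S := ⟨h.1, h.2.1⟩

/-- In an acyclic graph, two different neighbours of `r` are separated by removing `r`. -/
lemma eq_of_reachable_removeVertex (hG : G.IsAcyclic) {c c' : V} (hc : G.Adj r c)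
    (hc' : G.Adj r c') (h : (removeVertex G r).Reachable c c') : c = c' := by
  by_contra hne
  have hb := SimpleGraph.isAcyclic_iff_forall_adj_isBridge.1 hG hc
  rw [SimpleGraph.isBridge_iff] at hb
  apply hb
  have h1 : (G.deleteEdges {s(r, c)}).Adj r c' := by
    rw [SimpleGraph.deleteEdges_adj]
    refine ⟨hc', ?_⟩
    simp only [Set.mem_singleton_iff, Sym2.eq_iff]
    rintro (⟨-, h⟩ | ⟨h, -⟩)
    · exact hne h.symm
    · exact hc.ne h
  have h2 : removeVertex G r ≤ G.deleteEdges {s(r, c)} := by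
    intro x y hxy
    rw [SimpleGraph.deleteEdges_adj]
    refine ⟨hxy.1, ?_⟩
    simp only [Set.mem_singleton_iff, Sym2.eq_iff]
    rintro (⟨h, -⟩ | ⟨-, h⟩)
    · exact hxy.2.1 h
    · exact hxy.2.2 h
  exact h1.reachable.trans (h.mono h2).symm

lemma exists_adj_reachable_removeVertex (h : G.Reachable r w) (hw : w ≠ r) :
    ∃ c, G.Adj r c ∧ (removeVertex G r).Reachable c w := by
  classical
  have := reachable_induction (G := G) (v := r) (w := w)
    (p := fun w => w = r ∨ ∃ c, G.Adj r c ∧ (removeVertex G r).Reachable c w) ?_ h (Or.inl rfl)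
  · exact this.resolve_left hw
  · intro x y hx hxy
    by_cases hy : y = r
    · exact Or.inl hy
    right
    rcases hx with rfl | ⟨c, hc, hcx⟩
    · exact ⟨y, hxy, .refl _⟩
    · by_cases hxr : x = r
      · subst hxr
        exact ⟨y, hxy, .refl _⟩
      · exact ⟨c, hc, hcx.trans (SimpleGraph.Adj.reachable ⟨hxy, hxr, hy⟩)⟩

open scoped Classical in
/-- The vertices of `S` in the branch of `G` at `c` away from `r`. -/
noncomputable def branch (G : SimpleGraph V) (S : Finset V) (r c : V) : Finset V :=
  {w ∈ S | (removeVertex G r).Reachable c w}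

open scoped Classical in
/-- The vertices of `S` in the component of `v`. -/
noncomputable def component (G : SimpleGraph V) (S : Finset V) (v : V) : Finset V :=
  {w ∈ S | G.Reachable v w}

lemma mem_branch : w ∈ branch G S r c ↔ w ∈ S ∧ (removeVertex G r).Reachable c w := by
  classical simp [branch]

lemma mem_component : w ∈ component G S v ↔ w ∈ S ∧ G.Reachable v w := by
  classical simp [component]

lemma branch_subset : branch G S r c ⊆ S := fun _ h => (mem_branch.1 h).1

lemma component_subset : component G S v ⊆ S := fun _ h => (mem_component.1 h).1

lemma notMem_branch (hc : G.Adj r c) : r ∉ branch G S r c := fun h =>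
  not_reachable_removeVertex hc.ne' (mem_branch.1 h).2

lemma mem_branch_self (hG : SupportedOn G S) (hc : G.Adj r c) : c ∈ branch G S r c :=
  mem_branch.2 ⟨hG hc.symm, .refl _⟩

/-- Only the edge from `c` to `r` leaves the branch at `c`. -/
lemma adj_branch (hG : IsForestOn G S) (hc : G.Adj r c) (h : G.Adj v w)
    (hv : v ∈ branch G S r c) (hw : w ∉ branch G S r c) : v = c ∧ w = r := by
  have hvr : v ≠ r := fun e => notMem_branch hc (e ▸ hv)
  have hwr : w = r := by
    by_contra hwr
    exact hw (mem_branch.2 ⟨hG.2 h.symm,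
      (mem_branch.1 hv).2.trans (SimpleGraph.Adj.reachable ⟨h, hvr, hwr⟩)⟩)
  subst hwr
  exact ⟨(eq_of_reachable_removeVertex hG.1 hc h.symm (mem_branch.1 hv).2).symm, rfl⟩

lemma adj_component (hG : SupportedOn G S) (h : G.Adj v w) (hv : v ∈ component G S r) :
    w ∈ component G S r :=
  mem_component.2 ⟨hG h.symm, (mem_component.1 hv).2.trans h.reachable⟩

open scoped Classical in
/-- The branches of a tree at `r` partition the vertices different from `r`. -/
lemma sum_card_branch [Fintype V] (hG : IsTreeOn G S) (hr : r ∈ S) :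
    ∑ c with G.Adj r c, (branch G S r c).card + 1 = S.card := by
  rw [← Finset.card_biUnion]
  · have : (Finset.univ.filter (fun c => G.Adj r c)).biUnion (fun c => branch G S r c) =
        S.erase r := by
      ext w
      simp only [Finset.mem_biUnion, Finset.mem_filter, Finset.mem_univ, true_and,
        Finset.mem_erase, mem_branch]
      constructor
      · rintro ⟨c, hc, hwS, hcw⟩
        exact ⟨fun e => not_reachable_removeVertex hc.ne' (e ▸ hcw), hwS⟩
      · rintro ⟨hwr, hwS⟩
        obtain ⟨c, hc, hcw⟩ := exists_adj_reachable_removeVertex (hG.2.2 r hr w hwS) hwr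
        exact ⟨c, hc, hwS, hcw⟩
    rw [this, Finset.card_erase_add_one hr]
  · intro c hc c' hc' hne
    rw [Finset.mem_coe, Finset.mem_filter] at hc hc'
    rw [Function.onFun, Finset.disjoint_left]
    intro w hw hw'
    exact hne (eq_of_reachable_removeVertex hG.1 hc.2 hc'.2
      ((mem_branch.1 hw).2.trans (mem_branch.1 hw').2.symm))

variable [DecidableEq V]

lemma IsTreeOn.restrict_branch (hG : IsTreeOn G S) (hc : G.Adj r c) :
    IsTreeOn (restrict G (branch G S r c)) (branch G S r c) := by
  refine ⟨(isForestOn_restrict hG.isForestOn _).1, supportedOn_restrict _ _, ?_⟩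
  have key : ∀ w ∈ branch G S r c, (restrict G (branch G S r c)).Reachable c w := by
    intro w hw
    refine (reachable_induction (p := fun w => w ∈ branch G S r c ∧
      (restrict G (branch G S r c)).Reachable c w) ?_ (mem_branch.1 hw).2
      ⟨mem_branch_self hG.2.1 hc, .refl _⟩).2
    rintro x y ⟨hx, hcx⟩ hxy
    have hy : y ∈ branch G S r c := by
      by_contra hy
      exact hxy.2.2 (adj_branch hG.isForestOn hc hxy.1 hx hy).2
    exact ⟨hy, hcx.trans (SimpleGraph.Adj.reachable ⟨hxy.1, hx, hy⟩)⟩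
  exact fun v hv w hw => (key v hv).symm.trans (key w hw)

lemma IsTreeOn.restrict_sdiff_branch (hG : IsTreeOn G S) (hc : G.Adj r c) :
    IsTreeOn (restrict G (S \ branch G S r c)) (S \ branch G S r c) := by
  refine ⟨(isForestOn_restrict hG.isForestOn _).1, supportedOn_restrict _ _, ?_⟩
  have hr : r ∈ S \ branch G S r c := Finset.mem_sdiff.2 ⟨hG.2.1 hc, notMem_branch hc⟩
  have key : ∀ w ∈ S \ branch G S r c, (restrict G (S \ branch G S r c)).Reachable r w := by
    intro w hw
    rw [Finset.mem_sdiff] at hw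
    by_cases hwr : w = r
    · rw [hwr]
    obtain ⟨c', hc', hcw'⟩ :=
      exists_adj_reachable_removeVertex (hG.2.2 r (hG.2.1 hc) w hw.1) hwr
    have hcS : c' ∈ S \ branch G S r c := by
      rw [Finset.mem_sdiff]
      refine ⟨hG.2.1 hc'.symm, fun h => hw.2 ?_⟩
      exact mem_branch.2 ⟨hw.1, (mem_branch.1 h).2.trans hcw'⟩
    refine (reachable_induction (p := fun w => w ∈ S \ branch G S r c ∧
      (restrict G (S \ branch G S r c)).Reachable r w) ?_ hcw'
      ⟨hcS, SimpleGraph.Adj.reachable ⟨hc', hr, hcS⟩⟩).2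
    rintro x y ⟨hx, hcx⟩ hxy
    have hy : y ∈ S \ branch G S r c := by
      rw [Finset.mem_sdiff] at hx ⊢
      refine ⟨hG.2.1 hxy.1.symm, fun h => ?_⟩
      exact hxy.2.1 (adj_branch hG.isForestOn hc hxy.1.symm h hx.2).2
    exact ⟨hy, hcx.trans (SimpleGraph.Adj.reachable ⟨hxy.1, hx, hy⟩)⟩
  exact fun v hv w hw => (key v hv).symm.trans (key w hw)

omit [DecidableEq V] in
lemma IsTreeOn.restrict_component (hG : IsForestOn G S) (hv : v ∈ S) :
    IsTreeOn (restrict G (component G S v)) (component G S v) := by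
  refine ⟨(isForestOn_restrict hG _).1, supportedOn_restrict _ _, ?_⟩
  have key : ∀ w ∈ component G S v, (restrict G (component G S v)).Reachable v w := by
    intro w hw
    refine (reachable_induction (p := fun w => w ∈ component G S v ∧
      (restrict G (component G S v)).Reachable v w) ?_ (mem_component.1 hw).2
      ⟨mem_component.2 ⟨hv, .refl _⟩, .refl _⟩).2
    rintro x y ⟨hx, hcx⟩ hxy
    have hy := adj_component hG.2 hxy hx
    exact ⟨hy, hcx.trans (SimpleGraph.Adj.reachable ⟨hxy, hx, hy⟩)⟩
  exact fun v hv w hw => (key v hv).symm.trans (key w hw)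

/-- A tree is glued from its branch at `c`, the rest, and the edge between them. -/
lemma IsForestOn.eq_sup_branch (hG : IsForestOn G S) (hc : G.Adj r c) :
    restrict G (S \ branch G S r c) ⊔ restrict G (branch G S r c) ⊔ SimpleGraph.edge r c = G := by
  ext v w
  simp only [SimpleGraph.sup_adj, restrict_adj, SimpleGraph.edge_adj, Finset.mem_sdiff]
  constructor
  · rintro ((h | h) | ⟨⟨rfl, rfl⟩ | ⟨rfl, rfl⟩, -⟩)
    · exact h.1
    · exact h.1
    · exact hc
    · exact hc.symm
  · intro h
    have h1 := hG.2 h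
    have h2 := hG.2 h.symm
    by_cases hv : v ∈ branch G S r c <;> by_cases hw : w ∈ branch G S r c
    · tauto
    · have := adj_branch hG hc h hv hw
      exact Or.inr ⟨Or.inr this, h.ne⟩
    · have := adj_branch hG hc h.symm hw hv
      exact Or.inr ⟨Or.inl this.symm, h.ne⟩
    · tauto

lemma IsForestOn.eq_sup_component (hG : IsForestOn G S) (v : V) :
    restrict G (S \ component G S v) ⊔ restrict G (component G S v) = G := by
  ext x y
  simp only [SimpleGraph.sup_adj, restrict_adj, Finset.mem_sdiff]
  refine ⟨fun h => h.elim And.left And.left, fun h => ?_⟩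
  have h1 := hG.2 h
  have h2 := hG.2 h.symm
  have h3 := adj_component (r := v) hG.2 h
  have h4 := adj_component (r := v) hG.2 h.symm
  tauto

section Glue

variable (hS : S₂ ⊆ S) (h₂ : IsTreeOn G₂ S₂)

include hS h₂

lemma component_sup (h₁ : IsForestOn G₁ (S \ S₂)) (hv : v ∈ S₂) :
    component (G₁ ⊔ G₂) S v = S₂ := by
  ext w
  rw [mem_component]
  constructor
  · rintro ⟨-, h⟩
    rw [sup_comm] at h
    exact (reachable_sup_left h₂.2.1
      (fun x y hxy hx => (Finset.mem_sdiff.1 (h₁.2 hxy)).2 hx) hv h).1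
  · exact fun hw => ⟨hS hw, (h₂.2.2 v hv w hw).mono le_sup_right⟩

omit h₂ in
lemma isForestOn_sup (h₂ : IsForestOn G₂ S₂) (h₁ : IsForestOn G₁ (S \ S₂)) :
    IsForestOn (G₁ ⊔ G₂) S := by
  refine ⟨isAcyclic_sup Finset.sdiff_disjoint h₁ h₂, ?_⟩
  rintro v w (h | h)
  · exact (Finset.mem_sdiff.1 (h₁.2 h)).1
  · exact hS (h₂.2 h)

omit hS h₂ in
lemma restrict_sup_right (h₂ : IsForestOn G₂ S₂) (h₁ : IsForestOn G₁ (S \ S₂)) :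
    restrict (G₁ ⊔ G₂) S₂ = G₂ := by
  ext v w
  simp only [restrict_adj, SimpleGraph.sup_adj]
  have := h₁.2 (v := v) (w := w)
  have := h₂.2 (v := v) (w := w)
  have := h₂.2 (v := w) (w := v)
  have := G₂.adj_comm v w
  rw [Finset.mem_sdiff] at *
  tauto

omit hS h₂ in
lemma restrict_sup_left (h₂ : IsForestOn G₂ S₂) (h₁ : IsForestOn G₁ (S \ S₂)) :
    restrict (G₁ ⊔ G₂) (S \ S₂) = G₁ := by
  ext v w
  simp only [restrict_adj, SimpleGraph.sup_adj, Finset.mem_sdiff]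
  have := h₁.2 (v := v) (w := w)
  have := h₁.2 (v := w) (w := v)
  have := h₂.2 (v := v) (w := w)
  have := G₁.adj_comm v w
  rw [Finset.mem_sdiff] at *
  tauto

variable (h₁ : IsTreeOn G₁ (S \ S₂)) (hr : r ∈ S \ S₂) (hc : c ∈ S₂)

include h₁ hr hc

lemma isTreeOn_sup_edge : IsTreeOn (G₁ ⊔ G₂ ⊔ SimpleGraph.edge r c) S := by
  have hr' := Finset.mem_sdiff.1 hr
  have hne : r ≠ c := fun e => hr'.2 (e ▸ hc)
  have hadj : (G₁ ⊔ G₂ ⊔ SimpleGraph.edge r c).Adj r c := by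
    simp [SimpleGraph.sup_adj, SimpleGraph.edge_adj, hne]
  refine ⟨SimpleGraph.IsAcyclic.sup_edge_of_not_reachable ?_
    (isForestOn_sup hS h₂.isForestOn h₁.isForestOn).1, ?_, ?_⟩
  · intro h
    rw [sup_comm] at h
    exact hr'.2 (reachable_sup_left (S₁ := S₂) h₂.2.1
      (fun x y hxy hx => (Finset.mem_sdiff.1 (h₁.2.1 hxy)).2 hx) hc h.symm).1
  · intro v w h
    rw [SimpleGraph.sup_adj, SimpleGraph.edge_adj] at h
    rcases h with h | ⟨⟨rfl, rfl⟩ | ⟨rfl, rfl⟩, -⟩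
    · exact (isForestOn_sup hS h₂.isForestOn h₁.isForestOn).2 h
    · exact hr'.1
    · exact hS hc
  · have key : ∀ v ∈ S, (G₁ ⊔ G₂ ⊔ SimpleGraph.edge r c).Reachable r v := by
      intro v hv
      by_cases hv₂ : v ∈ S₂
      · exact hadj.reachable.trans
          ((h₂.2.2 c hc v hv₂).mono (le_sup_right.trans le_sup_left))
      · exact (h₁.2.2 r hr v (Finset.mem_sdiff.2 ⟨hv, hv₂⟩)).mono
          (le_sup_left.trans le_sup_left)
    exact fun v hv w hw => (key v hv).symm.trans (key w hw)

lemma branch_sup_edge : branch (G₁ ⊔ G₂ ⊔ SimpleGraph.edge r c) S r c = S₂ := by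
  have hr' := Finset.mem_sdiff.1 hr
  ext w
  rw [mem_branch]
  constructor
  · rintro ⟨-, h⟩
    refine reachable_induction (p := fun w => w ∈ S₂) ?_ h hc
    rintro x y hx ⟨hxy, hxr, hyr⟩
    rw [SimpleGraph.sup_adj, SimpleGraph.sup_adj, SimpleGraph.edge_adj] at hxy
    rcases hxy with (h | h) | h
    · exact absurd hx (Finset.mem_sdiff.1 (h₁.2.1 h)).2
    · exact h₂.2.1 h.symm
    · tauto
  · intro hw
    refine ⟨hS hw, (h₂.2.2 c hc w hw).mono ?_⟩
    intro x y hxy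
    refine ⟨Or.inl (Or.inr hxy), ?_, ?_⟩
    · rintro rfl
      exact hr'.2 (h₂.2.1 hxy)
    · rintro rfl
      exact hr'.2 (h₂.2.1 hxy.symm)

omit hS in
lemma restrict_sup_edge_right : restrict (G₁ ⊔ G₂ ⊔ SimpleGraph.edge r c) S₂ = G₂ := by
  rw [Finset.mem_sdiff] at hr
  rw [← restrict_sup_right h₂.isForestOn h₁.isForestOn]
  ext v w
  simp only [restrict_adj, SimpleGraph.sup_adj, SimpleGraph.edge_adj]
  constructor
  · rintro ⟨h | ⟨⟨rfl, rfl⟩ | ⟨rfl, rfl⟩, -⟩, hv, hw⟩ <;> tauto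
  · tauto

omit hS in
lemma restrict_sup_edge_left : restrict (G₁ ⊔ G₂ ⊔ SimpleGraph.edge r c) (S \ S₂) = G₁ := by
  nth_rewrite 2 [← restrict_sup_left h₂.isForestOn h₁.isForestOn]
  ext v w
  simp only [restrict_adj, SimpleGraph.sup_adj, SimpleGraph.edge_adj, Finset.mem_sdiff]
  constructor
  · rintro ⟨h | ⟨⟨rfl, rfl⟩ | ⟨rfl, rfl⟩, -⟩, hv, hw⟩ <;> tauto
  · tauto

end Glue

end Graphs

section Weights

open scoped Classical

variable {V : Type*} {G : SimpleGraph V} {S J : Finset V} {v w r c : V}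

/-- `v` has a neighbour in `J`. -/
def Dominated (G : SimpleGraph V) (J : Finset V) (v : V) : Prop := ∃ w ∈ J, G.Adj v w

/-- `J` is an independent subset of `S`. -/
def IndepIn (G : SimpleGraph V) (S J : Finset V) : Prop :=
  J ⊆ S ∧ ∀ v ∈ J, ∀ w ∈ J, ¬ G.Adj v w

/-- A tree on `S` rooted at a vertex of the maximal independent set `J`. -/
def RootIn (G : SimpleGraph V) (S J : Finset V) (r : V) : Prop :=
  IsTreeOn G S ∧ IndepIn G S J ∧ (∀ v ∈ S, v ∉ J → Dominated G J v) ∧ r ∈ J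

/-- A tree on `S` rooted at a vertex outside the maximal independent set `J`. -/
def RootOut (G : SimpleGraph V) (S J : Finset V) (r : V) : Prop :=
  IsTreeOn G S ∧ IndepIn G S J ∧ (∀ v ∈ S, v ∉ J → Dominated G J v) ∧ r ∈ S ∧ r ∉ J

/-- A tree on `S` with an independent set `J` dominating precisely the non-root vertices. -/
def RootPending (G : SimpleGraph V) (S J : Finset V) (r : V) : Prop :=
  IsTreeOn G S ∧ IndepIn G S J ∧ (∀ v ∈ S, v ∉ J → (Dominated G J v ↔ v ≠ r)) ∧ r ∈ S ∧ r ∉ J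

/-- A forest on `S` with a maximal independent set `J`. -/
def ForestPair (G : SimpleGraph V) (S J : Finset V) : Prop :=
  IsForestOn G S ∧ IndepIn G S J ∧ ∀ v ∈ S, v ∉ J → Dominated G J v

/-- All vertices outside `J`, except possibly the root, are dominated by `J`. -/
def NonrootDominated (G : SimpleGraph V) (S J : Finset V) (r : V) : Prop :=
  ∀ v ∈ S, v ∉ J → v ≠ r → Dominated G J v

lemma forall_iff_ne_and_root (hr : r ∈ S) {p : V → Prop} :
    (∀ v ∈ S, v ∉ J → p v) ↔ (∀ v ∈ S, v ∉ J → v ≠ r → p v) ∧ (r ∉ J → p r) := by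
  constructor
  · exact fun h => ⟨fun v hv hJ _ => h v hv hJ, h r hr⟩
  · rintro ⟨h1, h2⟩ v hv hJ
    by_cases hvr : v = r
    · exact hvr ▸ h2 (hvr ▸ hJ)
    exact h1 v hv hJ hvr

lemma rootIn_iff (hr : r ∈ S) : RootIn G S J r ↔
    IsTreeOn G S ∧ IndepIn G S J ∧ NonrootDominated G S J r ∧ r ∈ J := by
  rw [RootIn, forall_iff_ne_and_root hr, NonrootDominated]
  tauto

lemma rootOut_iff (hr : r ∈ S) : RootOut G S J r ↔
    IsTreeOn G S ∧ IndepIn G S J ∧ NonrootDominated G S J r ∧ Dominated G J r ∧ r ∉ J := by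
  rw [RootOut, forall_iff_ne_and_root hr, NonrootDominated]
  tauto

lemma rootPending_iff (hr : r ∈ S) : RootPending G S J r ↔
    IsTreeOn G S ∧ IndepIn G S J ∧ NonrootDominated G S J r ∧ ¬ Dominated G J r ∧ r ∉ J := by
  have h : (∀ v ∈ S, v ∉ J → v ≠ r → (Dominated G J v ↔ v ≠ r)) ↔ NonrootDominated G S J r :=
    forall₄_congr fun v _ _ hv => by simp [hv]
  rw [RootPending, forall_iff_ne_and_root hr, h]
  simp only [ne_eq, not_true_eq_false, iff_false]
  tauto

section Cut

variable (hG : IsTreeOn G S) (hJ : J ⊆ S) (hc : G.Adj r c)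

include hG hJ hc

omit hJ in
lemma dominated_branch (hv : v ∈ branch G S r c) :
    Dominated G J v ↔
      Dominated (restrict G (branch G S r c)) (J ∩ branch G S r c) v ∨ (v = c ∧ r ∈ J) := by
  constructor
  · rintro ⟨w, hw, hvw⟩
    by_cases hwb : w ∈ branch G S r c
    · exact Or.inl ⟨w, Finset.mem_inter.2 ⟨hw, hwb⟩, hvw, hv, hwb⟩
    · obtain ⟨h1, rfl⟩ := adj_branch hG.isForestOn hc hvw hv hwb
      exact Or.inr ⟨h1, hw⟩
  · rintro (⟨w, hw, hvw⟩ | ⟨rfl, hr⟩)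
    · exact ⟨w, (Finset.mem_inter.1 hw).1, hvw.1⟩
    · exact ⟨r, hr, hc.symm⟩

lemma dominated_sdiff_branch (hv : v ∈ S \ branch G S r c) :
    Dominated G J v ↔
      Dominated (restrict G (S \ branch G S r c)) (J \ branch G S r c) v ∨
        (v = r ∧ c ∈ J) := by
  constructor
  · rintro ⟨w, hw, hvw⟩
    by_cases hwb : w ∈ branch G S r c
    · obtain ⟨rfl, h1⟩ := adj_branch hG.isForestOn hc hvw.symm hwb (Finset.mem_sdiff.1 hv).2
      exact Or.inr ⟨h1, hw⟩
    · exact Or.inl ⟨w, Finset.mem_sdiff.2 ⟨hw, hwb⟩, hvw, hv, Finset.mem_sdiff.2 ⟨hJ hw, hwb⟩⟩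
  · rintro (⟨w, hw, hvw⟩ | ⟨rfl, hr⟩)
    · exact ⟨w, (Finset.mem_sdiff.1 hw).1, hvw.1⟩
    · exact ⟨c, hr, hc⟩

lemma indepIn_cut :
    IndepIn G S J ↔
      IndepIn (restrict G (S \ branch G S r c)) (S \ branch G S r c) (J \ branch G S r c) ∧
      IndepIn (restrict G (branch G S r c)) (branch G S r c) (J ∩ branch G S r c) ∧
      ¬ (r ∈ J ∧ c ∈ J) := by
  constructor
  · rintro ⟨-, h⟩
    refine ⟨⟨Finset.sdiff_subset_sdiff hJ subset_rfl, ?_⟩, ⟨Finset.inter_subset_right, ?_⟩,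
      fun h' => h r h'.1 c h'.2 hc⟩
    · intro v hv w hw hvw
      exact h v (Finset.mem_sdiff.1 hv).1 w (Finset.mem_sdiff.1 hw).1 hvw.1
    · intro v hv w hw hvw
      exact h v (Finset.mem_inter.1 hv).1 w (Finset.mem_inter.1 hw).1 hvw.1
  · rintro ⟨⟨-, h1⟩, ⟨-, h2⟩, h3⟩
    refine ⟨hJ, ?_⟩
    intro v hv w hw hvw
    by_cases hvb : v ∈ branch G S r c <;> by_cases hwb : w ∈ branch G S r c
    · exact h2 v (Finset.mem_inter.2 ⟨hv, hvb⟩) w (Finset.mem_inter.2 ⟨hw, hwb⟩) ⟨hvw, hvb, hwb⟩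
    · obtain ⟨rfl, rfl⟩ := adj_branch hG.isForestOn hc hvw hvb hwb
      exact h3 ⟨hw, hv⟩
    · obtain ⟨rfl, rfl⟩ := adj_branch hG.isForestOn hc hvw.symm hwb hvb
      exact h3 ⟨hv, hw⟩
    · exact h1 v (Finset.mem_sdiff.2 ⟨hv, hvb⟩) w (Finset.mem_sdiff.2 ⟨hw, hwb⟩)
        ⟨hvw, Finset.mem_sdiff.2 ⟨hJ hv, hvb⟩, Finset.mem_sdiff.2 ⟨hJ hw, hwb⟩⟩

/-- Domination away from the cut edge, expressed on the two parts. -/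
lemma forall_dominated_cut :
    (∀ v ∈ S, v ∉ J → v ≠ r → v ≠ c → Dominated G J v) ↔
      (∀ v ∈ S \ branch G S r c, v ∉ J \ branch G S r c → v ≠ r →
        Dominated (restrict G (S \ branch G S r c)) (J \ branch G S r c) v) ∧
      (∀ v ∈ branch G S r c, v ∉ J ∩ branch G S r c → v ≠ c →
        Dominated (restrict G (branch G S r c)) (J ∩ branch G S r c) v) := by
  have hcb := mem_branch_self hG.2.1 hc
  have hrb := notMem_branch (S := S) hc
  constructor
  · intro h
    constructor
    · intro v hv hvJ hvr
      have hv' := Finset.mem_sdiff.1 hv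
      have := h v hv'.1 (fun h => hvJ (Finset.mem_sdiff.2 ⟨h, hv'.2⟩)) hvr
        (fun e => hv'.2 (e ▸ hcb))
      exact ((dominated_sdiff_branch hG hJ hc hv).1 this).resolve_right fun e => hvr e.1
    · intro v hv hvJ hvc
      have := h v (branch_subset hv) (fun h => hvJ (Finset.mem_inter.2 ⟨h, hv⟩))
        (fun e => hrb (e ▸ hv)) hvc
      exact ((dominated_branch hG hc hv).1 this).resolve_right fun e => hvc e.1
  · rintro ⟨h1, h2⟩ v hv hvJ hvr hvc
    by_cases hvb : v ∈ branch G S r c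
    · exact (dominated_branch hG hc hvb).2
        (Or.inl (h2 v hvb (fun h => hvJ (Finset.mem_inter.1 h).1) hvc))
    · have hvS := Finset.mem_sdiff.2 ⟨hv, hvb⟩
      exact (dominated_sdiff_branch hG hJ hc hvS).2
        (Or.inl (h1 v hvS (fun h => hvJ (Finset.mem_sdiff.1 h).1) hvr))

lemma nonrootDominated_cut :
    NonrootDominated G S J r ↔
      NonrootDominated (restrict G (S \ branch G S r c)) (S \ branch G S r c)
        (J \ branch G S r c) r ∧
      NonrootDominated (restrict G (branch G S r c)) (branch G S r c) (J ∩ branch G S r c) c ∧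
      (c ∉ J → Dominated G J c) := by
  rw [← and_assoc, NonrootDominated, NonrootDominated, NonrootDominated,
    ← forall_dominated_cut hG hJ hc]
  constructor
  · exact fun h => ⟨fun v hv hJ hr _ => h v hv hJ hr, fun h' => h c (hG.2.1 hc.symm) h' hc.ne'⟩
  · rintro ⟨h1, h2⟩ v hv hJ hr
    by_cases hvc : v = c
    · exact hvc ▸ h2 (hvc ▸ hJ)
    exact h1 v hv hJ hr hvc

/-- The possible types of the two parts of a rooted tree obtained by cutting an edge at the
root. -/
lemma root_cut_iff :
    (RootIn G S J r ↔
      RootIn (restrict G (S \ branch G S r c)) (S \ branch G S r c) (J \ branch G S r c) r ∧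
      (RootOut (restrict G (branch G S r c)) (branch G S r c) (J ∩ branch G S r c) c ∨
        RootPending (restrict G (branch G S r c)) (branch G S r c) (J ∩ branch G S r c) c)) ∧
    (RootPending G S J r ↔
      RootPending (restrict G (S \ branch G S r c)) (S \ branch G S r c) (J \ branch G S r c) r ∧
      RootOut (restrict G (branch G S r c)) (branch G S r c) (J ∩ branch G S r c) c) ∧
    (RootOut G S J r ↔
      ((RootOut (restrict G (S \ branch G S r c)) (S \ branch G S r c) (J \ branch G S r c) r ∨
        RootPending (restrict G (S \ branch G S r c)) (S \ branch G S r c)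
          (J \ branch G S r c) r) ∧
      RootIn (restrict G (branch G S r c)) (branch G S r c) (J ∩ branch G S r c) c) ∨
      (RootOut (restrict G (S \ branch G S r c)) (S \ branch G S r c) (J \ branch G S r c) r ∧
      RootOut (restrict G (branch G S r c)) (branch G S r c) (J ∩ branch G S r c) c)) := by
  have hcb := mem_branch_self hG.2.1 hc
  have hrb := notMem_branch (S := S) hc
  have hrS : r ∈ S := hG.2.1 hc
  have hrs : r ∈ S \ branch G S r c := Finset.mem_sdiff.2 ⟨hrS, hrb⟩
  have hDr := dominated_sdiff_branch hG hJ hc hrs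
  have hDc := dominated_branch hG hc hcb (J := J)
  have hT1 := hG.restrict_sdiff_branch hc
  have hT2 := hG.restrict_branch hc
  have hr1 : r ∈ J \ branch G S r c ↔ r ∈ J := by simp [hrb]
  have hc1 : c ∈ J ∩ branch G S r c ↔ c ∈ J := by simp [hcb]
  rw [eq_self_iff_true, true_and] at hDr hDc
  rw [rootIn_iff hrS, rootIn_iff hrs, rootIn_iff hcb, rootOut_iff hrS, rootOut_iff hrs,
    rootOut_iff hcb, rootPending_iff hrS, rootPending_iff hrs, rootPending_iff hcb,
    nonrootDominated_cut hG hJ hc, indepIn_cut hG hJ hc, hDr, hDc, hr1, hc1]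
  generalize IndepIn (restrict G (S \ branch G S r c)) (S \ branch G S r c)
    (J \ branch G S r c) = a1
  generalize IndepIn (restrict G (branch G S r c)) (branch G S r c)
    (J ∩ branch G S r c) = a2
  generalize (Dominated (restrict G (S \ branch G S r c)) (J \ branch G S r c) r) = b1
  generalize (Dominated (restrict G (branch G S r c)) (J ∩ branch G S r c) c) = b2
  generalize NonrootDominated (restrict G (S \ branch G S r c)) (S \ branch G S r c)
        (J \ branch G S r c) r = n1
  generalize NonrootDominated (restrict G (branch G S r c)) (branch G S r c)
    (J ∩ branch G S r c) c = n2
  simp only [hG, hT1, hT2, true_and]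
  by_cases h1 : r ∈ J <;> by_cases h2 : c ∈ J <;> simp only [h1, h2, not_true_eq_false,
    not_false_eq_true, true_and, and_true, false_and, and_false, or_false, or_true, false_or,
    forall_true_left, false_imp_iff, and_self] <;> tauto

end Cut

end Weights

section Sums

open scoped Classical

variable {V : Type*}

/-- Rooted tree structures whose root lies in `S`. -/
def IsRooted (P : SimpleGraph V → Finset V → Finset V → V → Prop) : Prop :=
  ∀ ⦃G S J r⦄, P G S J r → IsTreeOn G S ∧ J ⊆ S ∧ r ∈ S

/-- Rooted structures of one of two types. -/
def Either (P Q : SimpleGraph V → Finset V → Finset V → V → Prop) (G : SimpleGraph V)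
    (S J : Finset V) (r : V) : Prop :=
  P G S J r ∨ Q G S J r

lemma isRooted_rootIn : IsRooted (V := V) RootIn := fun _ _ _ _ h => ⟨h.1, h.2.1.1, h.2.1.1 h.2.2.2⟩

lemma isRooted_rootOut : IsRooted (V := V) RootOut := fun _ _ _ _ h => ⟨h.1, h.2.1.1, h.2.2.2.1⟩

lemma isRooted_rootPending : IsRooted (V := V) RootPending :=
  fun _ _ _ _ h => ⟨h.1, h.2.1.1, h.2.2.2.1⟩

lemma IsRooted.either {P Q : SimpleGraph V → Finset V → Finset V → V → Prop} (hP : IsRooted P)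
    (hQ : IsRooted Q) : IsRooted (Either P Q) :=
  fun _ _ _ _ h => h.elim (@hP _ _ _ _) (@hQ _ _ _ _)

lemma rootOut_not_rootPending (G : SimpleGraph V) (S J : Finset V) (r : V) (h : RootOut G S J r) :
    ¬ RootPending G S J r := by
  rw [rootPending_iff h.2.2.2.1]
  rw [rootOut_iff h.2.2.2.1] at h
  tauto

lemma not_rootIn_of_either (G : SimpleGraph V) (S J : Finset V) (r : V)
    (h : Either RootOut RootPending G S J r) : ¬ RootIn G S J r := fun h' =>
  h.elim (fun h => h.2.2.2.2 h'.2.2.2) fun h => h.2.2.2.2 h'.2.2.2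

variable [Fintype V]

/-- The sum of `u ^ |J|` over all rooted structures on `S` satisfying `P`. -/
noncomputable def weight (u : ℂ) (P : SimpleGraph V → Finset V → Finset V → V → Prop)
    (S : Finset V) : ℂ :=
  ∑ x : SimpleGraph V × Finset V × V with P x.1 S x.2.1 x.2.2, u ^ x.2.1.card

/-- The sum of `u ^ |J|` over all forests on `S` with a maximal independent set `J`. -/
noncomputable def forestWeight (u : ℂ) (S : Finset V) : ℂ :=
  ∑ x : SimpleGraph V × Finset V with ForestPair x.1 S x.2, u ^ x.2.card

lemma weight_eq_zero_of_empty {P : SimpleGraph V → Finset V → Finset V → V → Prop}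
    (hP : IsRooted P) (u : ℂ) : weight u P ∅ = 0 := by
  rw [weight, Finset.filter_false_of_mem, Finset.sum_empty]
  intro x _ h
  exact absurd (hP h).2.2 (Finset.notMem_empty _)

lemma weight_or {P Q : SimpleGraph V → Finset V → Finset V → V → Prop}
    (h : ∀ G S J r, P G S J r → ¬ Q G S J r) (u : ℂ) (S : Finset V) :
    weight u (Either P Q) S = weight u P S + weight u Q S := by
  simp only [weight]
  rw [← Finset.sum_union]
  · refine Finset.sum_congr ?_ fun _ _ => rfl
    ext x
    rw [Finset.mem_union, Finset.mem_filter_univ, Finset.mem_filter_univ, Finset.mem_filter_univ]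
    rfl
  · rw [Finset.disjoint_filter]
    exact fun x _ => h _ _ _ _

/-- Gluing two rooted trees along an edge between their roots. -/
lemma sum_weight_mul_weight {P Q : SimpleGraph V → Finset V → Finset V → V → Prop}
    (hP : IsRooted P) (hQ : IsRooted Q) (u : ℂ) (S : Finset V) :
    ∑ S₂ ∈ S.powerset, (S₂.card : ℂ) * (weight u P (S \ S₂) * weight u Q S₂) =
      ∑ y : SimpleGraph V × Finset V × V × V with
        (IsTreeOn y.1 S ∧ y.2.1 ⊆ S ∧ y.1.Adj y.2.2.1 y.2.2.2) ∧
        P (restrict y.1 (S \ branch y.1 S y.2.2.1 y.2.2.2)) (S \ branch y.1 S y.2.2.1 y.2.2.2)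
          (y.2.1 \ branch y.1 S y.2.2.1 y.2.2.2) y.2.2.1 ∧
        Q (restrict y.1 (branch y.1 S y.2.2.1 y.2.2.2)) (branch y.1 S y.2.2.1 y.2.2.2)
          (y.2.1 ∩ branch y.1 S y.2.2.1 y.2.2.2) y.2.2.2,
        ((branch y.1 S y.2.2.1 y.2.2.2).card : ℂ) * u ^ y.2.1.card := by
  simp_rw [weight, Finset.sum_mul_sum, Finset.mul_sum, ← Finset.sum_product']
  rw [Finset.sum_sigma']
  refine Finset.sum_bij'
    (fun p _ => (p.2.1.1 ⊔ p.2.2.1 ⊔ SimpleGraph.edge p.2.1.2.2 p.2.2.2.2,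
      p.2.1.2.1 ∪ p.2.2.2.1, p.2.1.2.2, p.2.2.2.2))
    (fun y _ => ⟨branch y.1 S y.2.2.1 y.2.2.2,
      (restrict y.1 (S \ branch y.1 S y.2.2.1 y.2.2.2),
        y.2.1 \ branch y.1 S y.2.2.1 y.2.2.2, y.2.2.1),
      (restrict y.1 (branch y.1 S y.2.2.1 y.2.2.2),
        y.2.1 ∩ branch y.1 S y.2.2.1 y.2.2.2, y.2.2.2)⟩) ?_ ?_ ?_ ?_ ?_
  · rintro ⟨S₂, ⟨G₁, J₁, r⟩, ⟨G₂, J₂, c⟩⟩ h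
    simp only [Finset.mem_sigma, Finset.mem_powerset, Finset.mem_product, Finset.mem_filter,
      Finset.mem_univ, true_and] at h ⊢
    obtain ⟨hS, h₁, h₂⟩ := h
    obtain ⟨hT₁, hJ₁, hr⟩ := hP h₁
    obtain ⟨hT₂, hJ₂, hc⟩ := hQ h₂
    have hne : r ≠ c := fun e => (Finset.mem_sdiff.1 hr).2 (e ▸ hc)
    have e1 : (J₁ ∪ J₂) \ S₂ = J₁ := by
      ext x
      have := @hJ₁ x
      have := @hJ₂ x
      simp only [Finset.mem_sdiff, Finset.mem_union] at *
      tauto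
    have e2 : (J₁ ∪ J₂) ∩ S₂ = J₂ := by
      ext x
      have := @hJ₁ x
      have := @hJ₂ x
      simp only [Finset.mem_sdiff, Finset.mem_union, Finset.mem_inter] at *
      tauto
    rw [branch_sup_edge hS hT₂ hT₁ hr hc, restrict_sup_edge_left hT₂ hT₁ hr hc,
      restrict_sup_edge_right hT₂ hT₁ hr hc, e1, e2]
    refine ⟨⟨isTreeOn_sup_edge hS hT₂ hT₁ hr hc, ?_, ?_⟩, h₁, h₂⟩
    · exact Finset.union_subset (hJ₁.trans Finset.sdiff_subset) (hJ₂.trans hS)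
    · simp [SimpleGraph.sup_adj, SimpleGraph.edge_adj, hne]
  · rintro ⟨G, J, r, c⟩ h
    simp only [Finset.mem_sigma, Finset.mem_powerset, Finset.mem_product, Finset.mem_filter,
      Finset.mem_univ, true_and] at h ⊢
    exact ⟨branch_subset, h.2⟩
  · rintro ⟨S₂, ⟨G₁, J₁, r⟩, ⟨G₂, J₂, c⟩⟩ h
    simp only [Finset.mem_sigma, Finset.mem_powerset, Finset.mem_product, Finset.mem_filter,
      Finset.mem_univ, true_and] at h ⊢
    obtain ⟨hS, h₁, h₂⟩ := h
    obtain ⟨hT₁, hJ₁, hr⟩ := hP h₁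
    obtain ⟨hT₂, hJ₂, hc⟩ := hQ h₂
    have e1 : (J₁ ∪ J₂) \ S₂ = J₁ := by
      ext x
      have := @hJ₁ x
      have := @hJ₂ x
      simp only [Finset.mem_sdiff, Finset.mem_union] at *
      tauto
    have e2 : (J₁ ∪ J₂) ∩ S₂ = J₂ := by
      ext x
      have := @hJ₁ x
      have := @hJ₂ x
      simp only [Finset.mem_sdiff, Finset.mem_union, Finset.mem_inter] at *
      tauto
    rw [branch_sup_edge hS hT₂ hT₁ hr hc, restrict_sup_edge_left hT₂ hT₁ hr hc,
      restrict_sup_edge_right hT₂ hT₁ hr hc, e1, e2]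
  · rintro ⟨G, J, r, c⟩ h
    simp only [Finset.mem_filter, Finset.mem_univ, true_and] at h
    obtain ⟨⟨hG, hJ, hc⟩, -⟩ := h
    simp only [Finset.sdiff_union_inter, hG.isForestOn.eq_sup_branch hc]
  · rintro ⟨S₂, ⟨G₁, J₁, r⟩, ⟨G₂, J₂, c⟩⟩ h
    simp only [Finset.mem_sigma, Finset.mem_powerset, Finset.mem_product, Finset.mem_filter,
      Finset.mem_univ, true_and] at h ⊢
    obtain ⟨hS, h₁, h₂⟩ := h
    obtain ⟨hT₁, hJ₁, hr⟩ := hP h₁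
    obtain ⟨hT₂, hJ₂, hc⟩ := hQ h₂
    rw [branch_sup_edge hS hT₂ hT₁ hr hc, Finset.card_union_of_disjoint, pow_add]
    exact Finset.disjoint_of_subset_left hJ₁
      (Finset.disjoint_of_subset_right hJ₂ Finset.sdiff_disjoint)

lemma card_mul_weight {T : SimpleGraph V → Finset V → Finset V → V → Prop} (hT : IsRooted T)
    (u : ℂ) (S : Finset V) :
    (S.card : ℂ) * weight u T S = weight u T S +
      ∑ y : SimpleGraph V × Finset V × V × V with
        T y.1 S y.2.1 y.2.2.1 ∧ y.1.Adj y.2.2.1 y.2.2.2,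
        ((branch y.1 S y.2.2.1 y.2.2.2).card : ℂ) * u ^ y.2.1.card := by
  have h : ∀ f : SimpleGraph V × Finset V × V × V → ℂ,
      ∑ y : SimpleGraph V × Finset V × V × V with
        T y.1 S y.2.1 y.2.2.1 ∧ y.1.Adj y.2.2.1 y.2.2.2, f y =
      ∑ x : SimpleGraph V × Finset V × V with T x.1 S x.2.1 x.2.2,
        ∑ c with x.1.Adj x.2.2 c, f (x.1, x.2.1, x.2.2, c) := by
    intro f
    rw [Finset.sum_sigma']
    refine Finset.sum_bij' (fun y _ => ⟨(y.1, y.2.1, y.2.2.1), y.2.2.2⟩)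
      (fun p _ => (p.1.1, p.1.2.1, p.1.2.2, p.2)) ?_ ?_ ?_ ?_ ?_ <;> simp
  rw [h, weight, Finset.mul_sum, ← Finset.sum_add_distrib]
  refine Finset.sum_congr rfl fun x hx => ?_
  rw [Finset.mem_filter] at hx
  obtain ⟨hG, -, hr⟩ := hT hx.2
  dsimp only
  rw [← Finset.sum_mul, ← sum_card_branch hG hr]
  push_cast
  ring

lemma card_mul_weight_rootIn (u : ℂ) (S : Finset V) :
    (S.card : ℂ) * weight u RootIn S = weight u RootIn S +
      ∑ S₂ ∈ S.powerset, (S₂.card : ℂ) *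
        (weight u RootIn (S \ S₂) * (weight u RootOut S₂ + weight u RootPending S₂)) := by
  rw [card_mul_weight isRooted_rootIn]
  simp_rw [← weight_or (P := RootOut) (Q := RootPending) rootOut_not_rootPending]
  rw [sum_weight_mul_weight isRooted_rootIn (isRooted_rootOut.either isRooted_rootPending)]
  congr 1
  refine Finset.sum_congr ?_ fun _ _ => rfl
  ext y
  rw [Finset.mem_filter_univ, Finset.mem_filter_univ]
  constructor
  · rintro ⟨h, hc⟩
    obtain ⟨hG, hJ, -⟩ := isRooted_rootIn h
    exact ⟨⟨hG, hJ, hc⟩, (root_cut_iff hG hJ hc).1.1 h⟩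
  · rintro ⟨⟨hG, hJ, hc⟩, h⟩
    exact ⟨(root_cut_iff hG hJ hc).1.2 h, hc⟩

lemma card_mul_weight_rootPending (u : ℂ) (S : Finset V) :
    (S.card : ℂ) * weight u RootPending S = weight u RootPending S +
      ∑ S₂ ∈ S.powerset, (S₂.card : ℂ) *
        (weight u RootPending (S \ S₂) * weight u RootOut S₂) := by
  rw [card_mul_weight isRooted_rootPending,
    sum_weight_mul_weight isRooted_rootPending isRooted_rootOut]
  congr 1
  refine Finset.sum_congr ?_ fun _ _ => rfl
  ext y
  rw [Finset.mem_filter_univ, Finset.mem_filter_univ]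
  constructor
  · rintro ⟨h, hc⟩
    obtain ⟨hG, hJ, -⟩ := isRooted_rootPending h
    exact ⟨⟨hG, hJ, hc⟩, (root_cut_iff hG hJ hc).2.1.1 h⟩
  · rintro ⟨⟨hG, hJ, hc⟩, h⟩
    exact ⟨(root_cut_iff hG hJ hc).2.1.2 h, hc⟩

lemma card_mul_weight_rootOut (u : ℂ) (S : Finset V) :
    (S.card : ℂ) * weight u RootOut S = weight u RootOut S +
      (∑ S₂ ∈ S.powerset, (S₂.card : ℂ) *
        ((weight u RootOut (S \ S₂) + weight u RootPending (S \ S₂)) * weight u RootIn S₂) +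
      ∑ S₂ ∈ S.powerset, (S₂.card : ℂ) *
        (weight u RootOut (S \ S₂) * weight u RootOut S₂)) := by
  rw [card_mul_weight isRooted_rootOut]
  simp_rw [← weight_or (P := RootOut) (Q := RootPending) rootOut_not_rootPending]
  rw [sum_weight_mul_weight (isRooted_rootOut.either isRooted_rootPending) isRooted_rootIn,
    sum_weight_mul_weight isRooted_rootOut isRooted_rootOut, ← Finset.sum_union]
  · congr 1
    refine Finset.sum_congr ?_ fun _ _ => rfl
    ext y
    rw [Finset.mem_union, Finset.mem_filter_univ, Finset.mem_filter_univ, Finset.mem_filter_univ]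
    constructor
    · rintro ⟨h, hc⟩
      obtain ⟨hG, hJ, -⟩ := isRooted_rootOut h
      rw [← and_or_left]
      exact ⟨⟨hG, hJ, hc⟩, (root_cut_iff hG hJ hc).2.2.1 h⟩
    · rw [← and_or_left]
      rintro ⟨⟨hG, hJ, hc⟩, h⟩
      exact ⟨(root_cut_iff hG hJ hc).2.2.2 h, hc⟩
  · rw [Finset.disjoint_filter]
    rintro y _ ⟨-, -, h⟩ ⟨-, -, h'⟩
    exact not_rootIn_of_either _ _ _ _ (Or.inl h') h

/-- Splitting off the component of a marked vertex of a forest. -/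
lemma card_mul_forestWeight (u : ℂ) (S : Finset V) :
    (S.card : ℂ) * forestWeight u S =
      ∑ S₂ ∈ S.powerset, forestWeight u (S \ S₂) * (weight u RootIn S₂ + weight u RootOut S₂) := by
  simp_rw [← weight_or (P := RootIn) (Q := RootOut)
    (fun G S J r h h' => not_rootIn_of_either G S J r (Or.inl h') h)]
  have hL : (S.card : ℂ) * forestWeight u S =
      ∑ p ∈ ({x : SimpleGraph V × Finset V | ForestPair x.1 S x.2} : Finset _) ×ˢ S,
        u ^ p.1.2.card := by
    rw [Finset.sum_product, forestWeight, Finset.mul_sum]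
    simp
  rw [hL]
  simp_rw [weight, forestWeight, Finset.sum_mul_sum, ← Finset.sum_product']
  rw [Finset.sum_sigma']
  symm
  have hQ : IsRooted (V := V) (Either RootIn RootOut) :=
    isRooted_rootIn.either isRooted_rootOut
  refine Finset.sum_bij'
    (fun p _ => ((p.2.1.1 ⊔ p.2.2.1, p.2.1.2 ∪ p.2.2.2.1), p.2.2.2.2))
    (fun y _ => ⟨component y.1.1 S y.2,
      (restrict y.1.1 (S \ component y.1.1 S y.2), y.1.2 \ component y.1.1 S y.2),
      (restrict y.1.1 (component y.1.1 S y.2), y.1.2 ∩ component y.1.1 S y.2, y.2)⟩)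
    ?_ ?_ ?_ ?_ ?_
  · rintro ⟨S₂, ⟨G₁, J₁⟩, ⟨G₂, J₂, v⟩⟩ h
    simp only [Finset.mem_sigma, Finset.mem_powerset, Finset.mem_product, Finset.mem_filter,
      Finset.mem_univ, true_and] at h ⊢
    obtain ⟨hS, h₁, h₂⟩ := h
    obtain ⟨hT₂, hJ₂, hv⟩ := hQ h₂
    refine ⟨⟨isForestOn_sup hS hT₂.isForestOn h₁.1, ⟨?_, ?_⟩, ?_⟩, hS hv⟩
    · exact Finset.union_subset (h₁.2.1.1.trans Finset.sdiff_subset) (hJ₂.trans hS)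
    · have hi₂ : ∀ v ∈ J₂, ∀ w ∈ J₂, ¬ G₂.Adj v w := h₂.elim (fun h => h.2.1.2) fun h => h.2.1.2
      rintro x hx y hy (hxy | hxy) <;> rw [Finset.mem_union] at hx hy
      · have hx' := h₁.1.2 hxy
        have hy' := h₁.1.2 hxy.symm
        rw [Finset.mem_sdiff] at hx' hy'
        exact h₁.2.1.2 x (hx.resolve_right fun h => hx'.2 (hJ₂ h)) y
          (hy.resolve_right fun h => hy'.2 (hJ₂ h)) hxy
      · have hx' := hT₂.2.1 hxy
        have hy' := hT₂.2.1 hxy.symm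
        exact hi₂ x (hx.resolve_left fun h => (Finset.mem_sdiff.1 (h₁.2.1.1 h)).2 hx') y
          (hy.resolve_left fun h => (Finset.mem_sdiff.1 (h₁.2.1.1 h)).2 hy') hxy
    · have hd₂ : ∀ v ∈ S₂, v ∉ J₂ → Dominated G₂ J₂ v :=
        h₂.elim (fun h => h.2.2.1) fun h => h.2.2.1
      intro x hx hxJ
      rw [Finset.mem_union, not_or] at hxJ
      by_cases hx₂ : x ∈ S₂
      · obtain ⟨w, hw, hxw⟩ := hd₂ x hx₂ hxJ.2
        exact ⟨w, Finset.mem_union_right _ hw, Or.inr hxw⟩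
      · obtain ⟨w, hw, hxw⟩ := h₁.2.2 x (Finset.mem_sdiff.2 ⟨hx, hx₂⟩) hxJ.1
        exact ⟨w, Finset.mem_union_left _ hw, Or.inl hxw⟩
  · rintro ⟨⟨G, J⟩, v⟩ h
    simp only [Finset.mem_sigma, Finset.mem_powerset, Finset.mem_product, Finset.mem_filter,
      Finset.mem_univ, true_and] at h ⊢
    obtain ⟨⟨hG, ⟨hJ, hi⟩, hd⟩, hv⟩ := h
    have hT := IsTreeOn.restrict_component hG hv
    have hd₂ : ∀ x ∈ component G S v, x ∉ J ∩ component G S v →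
        Dominated (restrict G (component G S v)) (J ∩ component G S v) x := by
      intro x hx hxJ
      obtain ⟨w, hw, hxw⟩ := hd x (component_subset hx)
        (fun h => hxJ (Finset.mem_inter.2 ⟨h, hx⟩))
      have hwc := adj_component hG.2 hxw hx
      exact ⟨w, Finset.mem_inter.2 ⟨hw, hwc⟩, hxw, hx, hwc⟩
    have hi₂ : IndepIn (restrict G (component G S v)) (component G S v)
        (J ∩ component G S v) :=
      ⟨Finset.inter_subset_right, fun x hx y hy hxy =>
        hi x (Finset.mem_inter.1 hx).1 y (Finset.mem_inter.1 hy).1 hxy.1⟩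
    have hvc : v ∈ component G S v := mem_component.2 ⟨hv, .refl _⟩
    refine ⟨component_subset, ⟨isForestOn_restrict hG _, ⟨Finset.sdiff_subset_sdiff hJ subset_rfl,
      fun x hx y hy hxy => hi x (Finset.mem_sdiff.1 hx).1 y (Finset.mem_sdiff.1 hy).1 hxy.1⟩,
      ?_⟩, ?_⟩
    · intro x hx hxJ
      have hx' := Finset.mem_sdiff.1 hx
      obtain ⟨w, hw, hxw⟩ := hd x hx'.1 (fun h => hxJ (Finset.mem_sdiff.2 ⟨h, hx'.2⟩))
      have hwc : w ∉ component G S v := fun h => hx'.2 (adj_component hG.2 hxw.symm h)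
      exact ⟨w, Finset.mem_sdiff.2 ⟨hw, hwc⟩, hxw, hx, Finset.mem_sdiff.2 ⟨hJ hw, hwc⟩⟩
    · by_cases hvJ : v ∈ J
      · exact Or.inl ⟨hT, hi₂, hd₂, Finset.mem_inter.2 ⟨hvJ, hvc⟩⟩
      · exact Or.inr ⟨hT, hi₂, hd₂, hvc, fun h => hvJ (Finset.mem_inter.1 h).1⟩
  · rintro ⟨S₂, ⟨G₁, J₁⟩, ⟨G₂, J₂, v⟩⟩ h
    simp only [Finset.mem_sigma, Finset.mem_powerset, Finset.mem_product, Finset.mem_filter,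
      Finset.mem_univ, true_and] at h ⊢
    obtain ⟨hS, h₁, h₂⟩ := h
    obtain ⟨hT₂, hJ₂, hv⟩ := hQ h₂
    have hJ₁ := h₁.2.1.1
    have e1 : (J₁ ∪ J₂) \ S₂ = J₁ := by
      ext x
      have := @hJ₁ x
      have := @hJ₂ x
      simp only [Finset.mem_sdiff, Finset.mem_union] at *
      tauto
    have e2 : (J₁ ∪ J₂) ∩ S₂ = J₂ := by
      ext x
      have := @hJ₁ x
      have := @hJ₂ x
      simp only [Finset.mem_sdiff, Finset.mem_union, Finset.mem_inter] at *
      tauto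
    rw [component_sup hS hT₂ h₁.1 hv, restrict_sup_left hT₂.isForestOn h₁.1,
      restrict_sup_right hT₂.isForestOn h₁.1, e1, e2]
  · rintro ⟨⟨G, J⟩, v⟩ h
    simp only [Finset.mem_product, Finset.mem_filter, Finset.mem_univ, true_and] at h
    simp only [Finset.sdiff_union_inter, h.1.1.eq_sup_component]
  · rintro ⟨S₂, ⟨G₁, J₁⟩, ⟨G₂, J₂, v⟩⟩ h
    simp only [Finset.mem_sigma, Finset.mem_powerset, Finset.mem_product, Finset.mem_filter,
      Finset.mem_univ, true_and] at h ⊢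
    obtain ⟨hS, h₁, h₂⟩ := h
    obtain ⟨hT₂, hJ₂, hv⟩ := hQ h₂
    rw [Finset.card_union_of_disjoint, pow_add]
    exact Finset.disjoint_of_subset_left h₁.2.1.1
      (Finset.disjoint_of_subset_right hJ₂ Finset.sdiff_disjoint)

omit [Fintype V] in
lemma eq_bot_of_supportedOn_singleton {G : SimpleGraph V} {v : V} (h : SupportedOn G {v}) :
    G = ⊥ := by
  ext x y
  refine ⟨fun hxy => ?_, fun hxy => hxy.elim⟩
  have hx := Finset.mem_singleton.1 (h hxy)
  have hy := Finset.mem_singleton.1 (h hxy.symm)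
  exact absurd (hx.trans hy.symm) hxy.ne

omit [Fintype V] in
lemma isTreeOn_bot_singleton (v : V) : IsTreeOn (⊥ : SimpleGraph V) {v} := by
  refine ⟨SimpleGraph.isAcyclic_bot, fun _ _ h => h.elim, ?_⟩
  simp

lemma weight_rootIn_singleton (u : ℂ) (v : V) : weight u RootIn {v} = u := by
  rw [weight, Finset.sum_eq_single_of_mem (⊥, {v}, v)]
  · simp
  · rw [Finset.mem_filter_univ]
    exact ⟨isTreeOn_bot_singleton v, ⟨subset_rfl, fun _ _ _ _ h => h.elim⟩,
      fun _ h h' => absurd h h', Finset.mem_singleton_self v⟩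
  · rintro ⟨G, J, r⟩ h hne
    rw [Finset.mem_filter_univ] at h
    obtain ⟨hG, ⟨hJ, -⟩, -, hr⟩ := h
    refine absurd ?_ hne
    have hrv := Finset.mem_singleton.1 (hJ hr)
    dsimp only at hr hrv hG hJ
    subst hrv
    rw [eq_bot_of_supportedOn_singleton hG.2.1,
      hJ.antisymm (Finset.singleton_subset_iff.2 hr)]

lemma weight_rootOut_singleton (u : ℂ) (v : V) : weight u RootOut {v} = 0 := by
  rw [weight, Finset.filter_false_of_mem, Finset.sum_empty]
  rintro ⟨G, J, r⟩ - ⟨hG, -, hd, hr, hrJ⟩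
  obtain ⟨w, -, hw⟩ := hd r hr hrJ
  dsimp only at hG
  rw [eq_bot_of_supportedOn_singleton hG.2.1] at hw
  exact hw.elim

lemma weight_rootPending_singleton (u : ℂ) (v : V) : weight u RootPending {v} = 1 := by
  rw [weight, Finset.sum_eq_single_of_mem (⊥, ∅, v)]
  · simp
  · rw [Finset.mem_filter_univ]
    refine ⟨isTreeOn_bot_singleton v, ⟨Finset.empty_subset _, fun _ h => by simp at h⟩,
      fun w hw _ => ?_, Finset.mem_singleton_self v, Finset.notMem_empty v⟩
    simp [Dominated, Finset.mem_singleton.1 hw]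
  · rintro ⟨G, J, r⟩ h hne
    rw [Finset.mem_filter_univ] at h
    obtain ⟨hG, ⟨hJ, -⟩, -, hr, hrJ⟩ := h
    refine absurd ?_ hne
    dsimp only at hr hrJ hG hJ
    rw [Finset.mem_singleton] at hr
    subst hr
    have hJe : J = ∅ := Finset.eq_empty_of_forall_notMem fun x hx =>
      hrJ (Finset.mem_singleton.1 (hJ hx) ▸ hx)
    rw [eq_bot_of_supportedOn_singleton hG.2.1, hJe]

lemma forestWeight_empty (u : ℂ) : forestWeight u (∅ : Finset V) = 1 := by
  rw [forestWeight, Finset.sum_eq_single_of_mem (⊥, ∅)]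
  · simp
  · rw [Finset.mem_filter_univ]
    exact ⟨⟨SimpleGraph.isAcyclic_bot, fun _ _ h => h.elim⟩, ⟨subset_rfl, fun _ h => by simp at h⟩,
      fun _ h => by simp at h⟩
  · rintro ⟨G, J⟩ h hne
    rw [Finset.mem_filter_univ] at h
    obtain ⟨hG, ⟨hJ, -⟩, -⟩ := h
    refine absurd ?_ hne
    dsimp only at hJ hG
    have hb : G = ⊥ := by
      ext x y
      exact ⟨fun hxy => absurd (hG.2 hxy) (Finset.notMem_empty _), fun hxy => hxy.elim⟩
    rw [hb, Finset.subset_empty.1 hJ]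

end Sums

section Recursion

open scoped Classical

variable {V : Type*}

lemma sum_powerset_card_mul {f g : Finset V → ℂ} {φ ψ : ℕ → ℂ} {S : Finset V}
    (hf0 : f ∅ = 0) (hφ0 : φ 0 = 0)
    (hf : ∀ T ⊆ S, T.card < S.card → f T = φ T.card)
    (hg : ∀ T ⊆ S, T.card < S.card → g T = ψ T.card) :
    ∑ S₂ ∈ S.powerset, (S₂.card : ℂ) * (f (S \ S₂) * g S₂) =
      ∑ i ∈ Finset.range (S.card + 1),
        (S.card.choose i : ℂ) * φ i * (((S.card - i : ℕ) : ℂ) * ψ (S.card - i)) := by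
  rw [← Finset.sum_flip]
  have h := Finset.sum_powerset_apply_card
    (fun j => (j : ℂ) * (φ (S.card - j) * ψ j)) (x := S)
  refine (Finset.sum_congr rfl fun T hT => ?_).trans (h.trans (Finset.sum_congr rfl fun j hj => ?_))
  · rw [Finset.mem_powerset] at hT
    have hc := Finset.card_sdiff_add_card_eq_card hT
    rcases Nat.eq_zero_or_pos T.card with h0 | h0
    · simp [h0]
    rcases eq_or_ne T S with rfl | hne
    · simp [hf0, hφ0]
    · have hlt : T.card < S.card := Finset.card_lt_card (hT.ssubset_of_ne hne)
      rw [hf _ Finset.sdiff_subset (by omega), hg _ hT hlt]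
      congr 3
      omega
  · have hj' : j ≤ S.card := Nat.lt_succ_iff.1 (Finset.mem_range.1 hj)
    rw [Nat.choose_symm hj', Nat.sub_sub_self hj', nsmul_eq_mul]
    ring

/-- The convolution of `φ` with `j ↦ j * ψ j` for exponential generating functions. -/
def starConv (φ ψ : ℕ → ℂ) (n : ℕ) : ℂ :=
  ∑ i ∈ Finset.range (n + 1), (n.choose i : ℂ) * φ i * (((n - i : ℕ) : ℂ) * ψ (n - i))

variable [Fintype V]

theorem weight_eq_of_recursion {u : ℂ} {α γ δ : ℕ → ℂ} (hα0 : α 0 = 0) (hγ0 : γ 0 = 0)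
    (hδ0 : δ 0 = 0) (hα1 : α 1 = u) (hγ1 : γ 1 = 0) (hδ1 : δ 1 = 1)
    (hα : ∀ n : ℕ, (n : ℂ) * α n = α n + starConv α (fun j => γ j + δ j) n)
    (hδ : ∀ n : ℕ, (n : ℂ) * δ n = δ n + starConv δ γ n)
    (hγ : ∀ n : ℕ, (n : ℂ) * γ n =
      γ n + (starConv (fun j => γ j + δ j) α n + starConv γ γ n)) (S : Finset V) :
    weight u RootIn S = α S.card ∧ weight u RootOut S = γ S.card ∧
      weight u RootPending S = δ S.card := by
  induction S using Finset.strongInduction with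
  | H S ih =>
  have ih' : ∀ T ⊆ S, T.card < S.card → weight u RootIn T = α T.card ∧
      weight u RootOut T = γ T.card ∧ weight u RootPending T = δ T.card := fun T hT hc =>
    ih T (hT.ssubset_of_ne fun h => hc.ne (congrArg _ h))
  have z1 : weight u RootIn (∅ : Finset V) = 0 := weight_eq_zero_of_empty isRooted_rootIn u
  have z2 : weight u RootOut (∅ : Finset V) = 0 := weight_eq_zero_of_empty isRooted_rootOut u
  have z3 : weight u RootPending (∅ : Finset V) = 0 :=
    weight_eq_zero_of_empty isRooted_rootPending u
  rcases Nat.lt_or_ge 1 S.card with h1 | h1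
  · have hne : (S.card : ℂ) - 1 ≠ 0 := by
      rw [sub_ne_zero]
      exact_mod_cast h1.ne'
    refine ⟨mul_left_cancel₀ hne ?_, mul_left_cancel₀ hne ?_, mul_left_cancel₀ hne ?_⟩
    · have e1 := card_mul_weight_rootIn u S
      rw [sum_powerset_card_mul (φ := α) (ψ := fun j => γ j + δ j)
        (g := fun T => weight u RootOut T + weight u RootPending T) z1 hα0
        (fun T hT hc => (ih' T hT hc).1)
        (fun T hT hc => by rw [(ih' T hT hc).2.1, (ih' T hT hc).2.2])] at e1
      have e2 := hα S.card
      rw [starConv] at e2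
      linear_combination e1 - e2
    · have e1 := card_mul_weight_rootOut u S
      rw [sum_powerset_card_mul (φ := fun j => γ j + δ j) (ψ := α)
        (f := fun T => weight u RootOut T + weight u RootPending T)
        (by simp [z2, z3]) (by simp [hγ0, hδ0])
        (fun T hT hc => by rw [(ih' T hT hc).2.1, (ih' T hT hc).2.2])
        (fun T hT hc => (ih' T hT hc).1),
        sum_powerset_card_mul (φ := γ) (ψ := γ) z2 hγ0
        (fun T hT hc => (ih' T hT hc).2.1) (fun T hT hc => (ih' T hT hc).2.1)] at e1
      have e2 := hγ S.card
      rw [starConv, starConv] at e2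
      linear_combination e1 - e2
    · have e1 := card_mul_weight_rootPending u S
      rw [sum_powerset_card_mul (φ := δ) (ψ := γ) z3 hδ0
        (fun T hT hc => (ih' T hT hc).2.2) (fun T hT hc => (ih' T hT hc).2.1)] at e1
      have e2 := hδ S.card
      rw [starConv] at e2
      linear_combination e1 - e2
  · rcases Nat.le_one_iff_eq_zero_or_eq_one.1 h1 with h | h
    · rw [h, Finset.card_eq_zero.1 h, z1, z2, z3, hα0, hγ0, hδ0]
      exact ⟨rfl, rfl, rfl⟩
    · obtain ⟨v, rfl⟩ := Finset.card_eq_one.1 h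
      rw [Finset.card_singleton, weight_rootIn_singleton, weight_rootOut_singleton,
        weight_rootPending_singleton, hα1, hγ1, hδ1]
      exact ⟨rfl, rfl, rfl⟩

theorem forestWeight_eq_of_recursion {u : ℂ} {η ι : ℕ → ℂ} (hη0 : η 0 = 0)
    (hη : ∀ S : Finset V, weight u RootIn S + weight u RootOut S = η S.card) (hι0 : ι 0 = 1)
    (hι : ∀ n : ℕ, (n : ℂ) * ι n = ∑ i ∈ Finset.range (n + 1), (n.choose i : ℂ) * η i * ι (n - i))
    (S : Finset V) : forestWeight u S = ι S.card := by
  induction S using Finset.strongInduction with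
  | H S ih =>
  rcases S.eq_empty_or_nonempty with rfl | hS
  · rw [forestWeight_empty, Finset.card_empty, hι0]
  · have hne : (S.card : ℂ) ≠ 0 := by exact_mod_cast hS.card_pos.ne'
    refine mul_left_cancel₀ hne ?_
    rw [card_mul_forestWeight, hι]
    have h := Finset.sum_powerset_apply_card (fun j => ι (S.card - j) * η j) (x := S)
    refine (Finset.sum_congr rfl fun T hT => ?_).trans
      (h.trans (Finset.sum_congr rfl fun j hj => ?_))
    · rw [Finset.mem_powerset] at hT
      rw [hη]
      rcases T.eq_empty_or_nonempty with rfl | hT0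
      · simp [hη0]
      rw [ih _ (Finset.sdiff_ssubset hT hT0), Finset.card_sdiff_of_subset hT]
    · rw [nsmul_eq_mul]
      ring

end Recursion

section AnalyticInverse

lemma exists_analytic_inverse {g : ℂ → ℂ} (hg : AnalyticAt ℂ g 0) (hg0 : g 0 = 0)
    (hg1 : deriv g 0 ≠ 0) :
    ∃ d : ℂ → ℂ, AnalyticAt ℂ d 0 ∧ d 0 = 0 ∧ (∀ᶠ z in 𝓝 0, d (g z) = z) ∧
      ∀ᶠ x in 𝓝 0, g (d x) = x := by
  have hs : HasStrictDerivAt g (deriv g 0) 0 := hg.hasStrictDerivAt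
  have hE := hs.hasStrictFDerivAt_equiv hg1
  have hc : ContDiffAt ℂ ⊤ g 0 := hg.contDiffAt
  refine ⟨hE.localInverse, ?_, ?_, ?_, ?_⟩
  · have := hc.to_localInverse hE.hasFDerivAt (by simp)
    rw [hg0] at this
    exact ContDiffAt.analyticAt this
  · have := hE.localInverse_apply_image
    rwa [hg0] at this
  · exact hE.eventually_left_inverse
  · have := hE.eventually_right_inverse
    rwa [hg0] at this

lemma iteratedDeriv_mul_deriv (n : ℕ) {f : ℂ → ℂ} (hf : AnalyticAt ℂ f 0) :
    iteratedDeriv n (fun x => x * deriv f x) 0 = n * iteratedDeriv n f 0 := by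
  induction n generalizing f with
  | zero => simp
  | succ n ih =>
    have h : deriv (fun x => x * deriv f x) =ᶠ[𝓝 0]
        fun x => deriv f x + x * deriv (deriv f) x := by
      filter_upwards [hf.eventually_analyticAt] with x hx
      rw [deriv_fun_mul differentiableAt_fun_id hx.deriv.differentiableAt, deriv_id'']
      ring
    have hm : AnalyticAt ℂ (fun x => x * deriv (deriv f) x) 0 := analyticAt_id.mul hf.deriv.deriv
    rw [iteratedDeriv_succ', h.iteratedDeriv_eq, iteratedDeriv_fun_add hf.deriv.contDiffAt
      hm.contDiffAt, ih hf.deriv, ← iteratedDeriv_succ']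
    push_cast
    ring

lemma iteratedDeriv_mul_mul_deriv (n : ℕ) {f h : ℂ → ℂ} (hf : AnalyticAt ℂ f 0)
    (hh : AnalyticAt ℂ h 0) :
    iteratedDeriv n (fun x => f x * (x * deriv h x)) 0 =
      starConv (fun k => iteratedDeriv k f 0) (fun k => iteratedDeriv k h 0) n := by
  have hm : AnalyticAt ℂ (fun x => x * deriv h x) 0 := analyticAt_id.mul hh.deriv
  rw [iteratedDeriv_fun_mul hf.contDiffAt hm.contDiffAt]
  simp_rw [iteratedDeriv_mul_deriv _ hh]
  rfl

end AnalyticInverse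

section GeneratingFunctions

open Complex

/-- As a function of the generating function `z` of pending trees, the generating function of
trees rooted inside the independent set. -/
noncomputable def genIn (u z : ℂ) : ℂ := u * z * exp z

/-- As a function of the generating function `z` of pending trees, the generating function of
trees rooted outside the independent set. -/
noncomputable def genOut (u z : ℂ) : ℂ := z * (exp (genIn u z) - 1)

/-- The generating function of rooted trees. -/
noncomputable def genRooted (u z : ℂ) : ℂ := genIn u z + genOut u z

/-- The generating function of unrooted trees. -/
noncomputable def genTree (u z : ℂ) : ℂ :=
  genIn u z + genOut u z - genIn u z * (genOut u z + z) - genOut u z ^ 2 / 2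

lemma hasDerivAt_genIn {d : ℂ → ℂ} {d' x : ℂ} (u : ℂ) (hd : HasDerivAt d d' x) :
    HasDerivAt (fun x => genIn u (d x)) (genIn u (d x) * d' + u * exp (d x) * d') x := by
  have := (hd.const_mul u).mul hd.cexp
  refine this.congr_deriv ?_
  rw [genIn]
  ring

lemma hasDerivAt_genOut {d : ℂ → ℂ} {d' x : ℂ} (u : ℂ) (hd : HasDerivAt d d' x) :
    HasDerivAt (fun x => genOut u (d x)) (d' * (exp (genIn u (d x)) - 1) +
      d x * (exp (genIn u (d x)) * (genIn u (d x) * d' + u * exp (d x) * d'))) x :=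
  hd.mul ((hasDerivAt_genIn u hd).cexp.sub_const 1)

lemma analyticAt_genIn (u : ℂ) {d : ℂ → ℂ} {x : ℂ} (hd : AnalyticAt ℂ d x) :
    AnalyticAt ℂ (fun x => genIn u (d x)) x := by
  unfold genIn
  fun_prop

lemma analyticAt_genOut (u : ℂ) {d : ℂ → ℂ} {x : ℂ} (hd : AnalyticAt ℂ d x) :
    AnalyticAt ℂ (fun x => genOut u (d x)) x := by
  unfold genOut genIn
  fun_prop

lemma analyticAt_genTree (u : ℂ) {d : ℂ → ℂ} {x : ℂ} (hd : AnalyticAt ℂ d x) :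
    AnalyticAt ℂ (fun x => genTree u (d x)) x := by
  unfold genTree genOut genIn
  fun_prop

section System

variable {u : ℂ} {d : ℂ → ℂ} (hd : AnalyticAt ℂ d 0)
  (hdx : ∀ᶠ x in 𝓝 0, d x = x * exp (genOut u (d x)))

include hd hdx

lemma genSystem : ∀ᶠ x in 𝓝 0,
    (x * deriv d x = d x + d x * (x * deriv (fun x => genOut u (d x)) x)) ∧
    (x * deriv (fun x => genIn u (d x)) x = genIn u (d x) +
      genIn u (d x) * (x * deriv (fun x => genOut u (d x) + d x) x)) ∧
    (x * deriv (fun x => genOut u (d x)) x = genOut u (d x) +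
      ((genOut u (d x) + d x) * (x * deriv (fun x => genIn u (d x)) x) +
        genOut u (d x) * (x * deriv (fun x => genOut u (d x)) x))) ∧
    (x * deriv (fun x => exp (genTree u (d x))) x =
      (genIn u (d x) + genOut u (d x)) * exp (genTree u (d x))) := by
  filter_upwards [hd.eventually_analyticAt, hdx.eventually_nhds] with x hx hxd
  have h0 := hx.differentiableAt.hasDerivAt
  have hA := hasDerivAt_genIn u h0
  have hC := hasDerivAt_genOut u h0
  have hD : HasDerivAt d _ x :=
    ((hasDerivAt_id x).mul hC.cexp).congr_of_eventuallyEq hxd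
  have e0 := hxd.self_of_nhds
  have e1 := h0.unique hD
  have hT : HasDerivAt (fun x => genTree u (d x)) _ x :=
    ((hA.add hC).sub (hA.mul (hC.add h0))).sub ((hC.pow 2).div_const 2)
  have hCd : HasDerivAt (fun x => genOut u (d x) + d x) _ x := hC.add h0
  rw [hA.deriv, hC.deriv, hT.cexp.deriv, hCd.deriv]
  set d' := deriv d x
  set a' := genIn u (d x) * d' + u * exp (d x) * d' with ha'
  set c' := d' * (exp (genIn u (d x)) - 1) + d x * (exp (genIn u (d x)) * a') with hc'
  have k1 : x * d' = d x + d x * (x * c') := by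
    have : d' = exp (genOut u (d x)) + x * (exp (genOut u (d x)) * c') := by
      simpa using e1
    linear_combination x * this - (1 + x * c') * e0
  have hA0 : genIn u (d x) = u * d x * exp (d x) := rfl
  have hC0 : genOut u (d x) = d x * (exp (genIn u (d x)) - 1) := rfl
  have k2 : x * a' = genIn u (d x) + genIn u (d x) * (x * (c' + d')) := by
    linear_combination x * ha' + u * exp (d x) * k1 - (1 + x * c') * hA0
  have k3 : x * c' = genOut u (d x) + ((genOut u (d x) + d x) * (x * a') +
      genOut u (d x) * (x * c')) := by
    linear_combination x * hc' + (exp (genIn u (d x)) - 1) * k1 - (1 + x * c' + x * a') * hC0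
  refine ⟨k1, k2, k3, ?_⟩
  simp only [Pi.add_apply, Nat.cast_ofNat, Nat.add_one_sub_one, pow_one]
  linear_combination exp (genTree u (d x)) * (k2 + k3)

omit hd in
lemma inverse_zero : d 0 = 0 := by simpa using hdx.self_of_nhds

lemma deriv_inverse_zero : deriv d 0 = 1 := by
  have hC := hasDerivAt_genOut u hd.differentiableAt.hasDerivAt
  have hD : HasDerivAt d _ 0 :=
    ((hasDerivAt_id (0 : ℂ)).mul hC.cexp).congr_of_eventuallyEq hdx
  rw [hD.deriv]
  simp [inverse_zero hdx, genOut]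

variable {V : Type*} [Fintype V]

theorem weight_eq_iteratedDeriv (S : Finset V) :
    weight u RootIn S = iteratedDeriv S.card (fun x => genIn u (d x)) 0 ∧
      weight u RootOut S = iteratedDeriv S.card (fun x => genOut u (d x)) 0 ∧
      weight u RootPending S = iteratedDeriv S.card d 0 := by
  have hA := analyticAt_genIn u hd
  have hC := analyticAt_genOut u hd
  have hsys := genSystem hd hdx
  have hd0 := inverse_zero hdx
  have hd1 := deriv_inverse_zero hd hdx
  have h0 : HasDerivAt d 1 0 := hd1 ▸ hd.differentiableAt.hasDerivAt
  have hCd : ∀ k, iteratedDeriv k (fun x => genOut u (d x) + d x) 0 =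
      iteratedDeriv k (fun x => genOut u (d x)) 0 + iteratedDeriv k d 0 := fun k =>
    iteratedDeriv_fun_add hC.contDiffAt hd.contDiffAt
  have hCd' : AnalyticAt ℂ (fun x => genOut u (d x) + d x) 0 := hC.fun_add hd
  have hmA : AnalyticAt ℂ (fun x => x * deriv (fun x => genIn u (d x)) x) 0 :=
    analyticAt_id.mul hA.deriv
  have hmC : AnalyticAt ℂ (fun x => x * deriv (fun x => genOut u (d x)) x) 0 :=
    analyticAt_id.mul hC.deriv
  have hmCd : AnalyticAt ℂ (fun x => x * deriv (fun x => genOut u (d x) + d x) x) 0 :=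
    analyticAt_id.mul hCd'.deriv
  refine weight_eq_of_recursion (α := fun k => iteratedDeriv k (fun x => genIn u (d x)) 0)
    (γ := fun k => iteratedDeriv k (fun x => genOut u (d x)) 0)
    (δ := fun k => iteratedDeriv k d 0) ?_ ?_ ?_ ?_ ?_ ?_ ?_ ?_ ?_ S
  · simp [hd0, genIn]
  · simp [hd0, genOut]
  · simp [hd0]
  · simp only [iteratedDeriv_one, (hasDerivAt_genIn u h0).deriv]
    simp [hd0, genIn]
  · simp only [iteratedDeriv_one, (hasDerivAt_genOut u h0).deriv]
    simp [hd0, genIn]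
  · simp [iteratedDeriv_one, hd1]
  · intro n
    have e : (fun x => x * deriv (fun x => genIn u (d x)) x) =ᶠ[𝓝 0] fun x => genIn u (d x) +
        genIn u (d x) * (x * deriv (fun x => genOut u (d x) + d x) x) :=
      hsys.mono fun x hx => hx.2.1
    simp_rw [← hCd]
    rw [← iteratedDeriv_mul_deriv n hA, e.iteratedDeriv_eq,
      iteratedDeriv_fun_add hA.contDiffAt (hA.fun_mul hmCd).contDiffAt,
      iteratedDeriv_mul_mul_deriv n hA hCd']
  · intro n
    have e : (fun x => x * deriv d x) =ᶠ[𝓝 0] fun x => d x +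
        d x * (x * deriv (fun x => genOut u (d x)) x) :=
      hsys.mono fun x hx => hx.1
    rw [← iteratedDeriv_mul_deriv n hd, e.iteratedDeriv_eq,
      iteratedDeriv_fun_add hd.contDiffAt (hd.fun_mul hmC).contDiffAt,
      iteratedDeriv_mul_mul_deriv n hd hC]
  · intro n
    have e : (fun x => x * deriv (fun x => genOut u (d x)) x) =ᶠ[𝓝 0] fun x => genOut u (d x) +
        ((genOut u (d x) + d x) * (x * deriv (fun x => genIn u (d x)) x) +
          genOut u (d x) * (x * deriv (fun x => genOut u (d x)) x)) :=
      hsys.mono fun x hx => hx.2.2.1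
    simp_rw [← hCd]
    rw [← iteratedDeriv_mul_deriv n hC, e.iteratedDeriv_eq,
      iteratedDeriv_fun_add hC.contDiffAt
        ((hCd'.fun_mul hmA).fun_add (hC.fun_mul hmC)).contDiffAt,
      iteratedDeriv_fun_add (hCd'.fun_mul hmA).contDiffAt (hC.fun_mul hmC).contDiffAt,
      iteratedDeriv_mul_mul_deriv n hCd' hA, iteratedDeriv_mul_mul_deriv n hC hC]

theorem card_mul_forestWeight_eq_iteratedDeriv (S : Finset V) :
    (S.card : ℂ) * forestWeight u S =
      iteratedDeriv S.card (fun x => genRooted u (d x) * exp (genTree u (d x))) 0 := by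
  have hA := analyticAt_genIn u hd
  have hC := analyticAt_genOut u hd
  have hT := (analyticAt_genTree u hd).cexp'
  have hH : AnalyticAt ℂ (fun x => genRooted u (d x)) 0 := hA.fun_add hC
  have hd0 := inverse_zero hdx
  have hsys : (fun x => x * deriv (fun x => exp (genTree u (d x))) x) =ᶠ[𝓝 0]
      fun x => genRooted u (d x) * exp (genTree u (d x)) :=
    (genSystem hd hdx).mono fun x hx => hx.2.2.2
  have hadd : ∀ k, iteratedDeriv k (fun x => genRooted u (d x)) 0 =
      iteratedDeriv k (fun x => genIn u (d x)) 0 + iteratedDeriv k (fun x => genOut u (d x)) 0 :=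
    fun k => iteratedDeriv_fun_add hA.contDiffAt hC.contDiffAt
  rw [← hsys.iteratedDeriv_eq, iteratedDeriv_mul_deriv _ hT]
  congr 1
  refine forestWeight_eq_of_recursion (η := fun k => iteratedDeriv k (fun x => genRooted u (d x)) 0)
    (ι := fun k => iteratedDeriv k (fun x => exp (genTree u (d x))) 0) ?_ ?_ ?_ ?_ S
  · simp [hd0, genRooted, genIn, genOut]
  · intro S
    rw [(weight_eq_iteratedDeriv hd hdx S).1, (weight_eq_iteratedDeriv hd hdx S).2.1, hadd]
  · simp [hd0, genTree, genIn, genOut]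
  · intro n
    rw [← iteratedDeriv_mul_deriv n hT, hsys.iteratedDeriv_eq,
      iteratedDeriv_fun_mul hH.contDiffAt hT.contDiffAt]

end System

end GeneratingFunctions

section Lagrange

open Complex Metric

variable {c : ℂ → ℂ}

lemma hasDerivAt_mul_exp_neg (hc : Differentiable ℂ c) (z : ℂ) :
    HasDerivAt (fun z => z * exp (-c z)) (exp (-c z) * (1 - z * deriv c z)) z := by
  refine ((hasDerivAt_id z).mul (hc z).hasDerivAt.neg.cexp).congr_deriv ?_
  simp only [id, Pi.neg_apply]
  ring

lemma mul_exp_neg_ne_zero {z : ℂ} (hz : z ≠ 0) : z * exp (-c z) ≠ 0 :=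
  mul_ne_zero hz (exp_ne_zero _)

lemma circleIntegral_deriv_mul_inv_pow (hc : Differentiable ℂ c) {ρ : ℝ} (hρ : 0 < ρ) (k : ℕ) :
    (∮ z in C(0, ρ), exp (-c z) * (1 - z * deriv c z) * ((z * exp (-c z)) ^ (k + 1))⁻¹) =
      if k = 0 then 2 * Real.pi * I else 0 := by
  have hne : ∀ z ∈ sphere (0 : ℂ) ρ, z ≠ 0 := fun z hz => ne_of_mem_sphere hz hρ.ne'
  split_ifs with hk
  · subst hk
    have hdc : Continuous (deriv c) := hc.contDiff.continuous_deriv le_top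
    have h1 : CircleIntegrable (fun z : ℂ => (z - 0)⁻¹) 0 ρ := by
      refine ContinuousOn.circleIntegrable hρ.le (ContinuousOn.inv₀ (by fun_prop) ?_)
      simpa using hne
    have h2 : CircleIntegrable (fun z => deriv c z) 0 ρ :=
      hdc.continuousOn.circleIntegrable hρ.le
    have h3 : (∮ z in C(0, ρ), deriv c z) = 0 :=
      circleIntegral.integral_eq_zero_of_hasDerivWithinAt hρ.le
        fun z _ => (hc z).hasDerivAt.hasDerivWithinAt
    rw [circleIntegral.integral_congr (g := fun z => (z - 0)⁻¹ - deriv c z) hρ.le,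
      circleIntegral.integral_sub h1 h2, h3, circleIntegral.integral_sub_center_inv _ hρ.ne',
      sub_zero]
    intro z hz
    have := hne z hz
    have := exp_ne_zero (-c z)
    simp only [zero_add, pow_one, sub_zero]
    field_simp
  · refine circleIntegral.integral_eq_zero_of_hasDerivWithinAt
      (f := fun z => -(k : ℂ)⁻¹ * ((z * exp (-c z)) ^ k)⁻¹) hρ.le fun z hz => ?_
    have hg := mul_exp_neg_ne_zero (c := c) (hne z hz)
    refine ((((hasDerivAt_mul_exp_neg hc z).pow k).inv (pow_ne_zero k hg)).const_mul
      _).hasDerivWithinAt.congr_deriv ?_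
    have hk' : (k : ℂ) ≠ 0 := by exact_mod_cast hk
    obtain ⟨m, rfl⟩ := Nat.exists_eq_succ_of_ne_zero hk
    simp only [Nat.succ_eq_add_one, add_tsub_cancel_right, Pi.pow_apply]
    generalize z * exp (-c z) = g at hg ⊢
    push_cast at hk' ⊢
    field_simp
    ring

/-- Lagrange inversion: the Taylor coefficients of `G ∘ d`, where `d` inverts
`z ↦ z * exp (-c z)`. -/
theorem circleIntegral_lagrange (hc : Differentiable ℂ c) {G d : ℂ → ℂ}
    (hG : Differentiable ℂ G) (hd : AnalyticAt ℂ (fun x => G (d x)) 0)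
    (hdg : ∀ᶠ z in 𝓝 0, d (z * exp (-c z)) = z) (n : ℕ) {r : ℝ} (hr : 0 < r) :
    (∮ z in C(0, r), deriv G z * ((z * exp (-c z)) ^ n)⁻¹) =
      2 * Real.pi * I * n * (iteratedDeriv n (fun x => G (d x)) 0 / n.factorial) := by
  obtain ⟨Q, hQ, hP⟩ := hd.exists_eventuallyEq_sum_add_pow_mul (n + 1)
  set p : ℕ → ℂ := fun i => iteratedDeriv i (fun x => G (d x)) 0 with hp
  have hdc : Continuous (deriv c) := hc.contDiff.continuous_deriv le_top
  have hcc : Continuous c := hc.continuous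
  have hdG : Differentiable ℂ (deriv G) := hG.contDiff.differentiable_deriv_two
  have hg0 : Tendsto (fun z => z * exp (-c z)) (𝓝 0) (𝓝 0) := by
    have : Continuous (fun z => z * exp (-c z)) := by fun_prop
    simpa using this.tendsto 0
  obtain ⟨ε, hε, hball⟩ := Metric.eventually_nhds_iff_ball.1
    (hdg.and ((hg0.eventually hP).and (hg0.eventually hQ.eventually_analyticAt)))
  obtain ⟨ρ, hρ, hρε⟩ : ∃ ρ, 0 < ρ ∧ ρ < min ε r := exists_between (lt_min hε hr)
  have hρr : ρ < r := hρε.trans_le (min_le_right _ _)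
  have hsub : closedBall (0 : ℂ) ρ ⊆ ball 0 ε :=
    closedBall_subset_ball (hρε.trans_le (min_le_left _ _))
  have hne : ∀ z ∈ sphere (0 : ℂ) ρ, z ≠ 0 := fun z hz => ne_of_mem_sphere hz hρ.ne'
  -- shrink the contour
  have hdiff : ∀ z : ℂ, z ≠ 0 →
      DifferentiableAt ℂ (fun z => deriv G z * ((z * exp (-c z)) ^ n)⁻¹) z := fun z hz =>
    (hdG z).mul (((hasDerivAt_mul_exp_neg hc z).differentiableAt.pow n).inv
      (pow_ne_zero _ (mul_exp_neg_ne_zero hz)))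
  rw [circleIntegral_eq_of_differentiable_on_annulus_off_countable hρ hρr.le
    Set.countable_empty (f := fun z => deriv G z * ((z * exp (-c z)) ^ n)⁻¹)]
  rotate_left
  · intro z hz
    refine (hdiff z ?_).continuousAt.continuousWithinAt
    rintro rfl
    exact hz.2 (mem_ball_self hρ)
  · intro z hz
    refine hdiff z ?_
    rintro rfl
    exact hz.1.2 (mem_closedBall_self hρ.le)
  -- integrate by parts
  have hcont1 : ContinuousOn (fun z => deriv G z * ((z * exp (-c z)) ^ n)⁻¹) (sphere 0 ρ) :=
    fun z hz => (hdiff z (hne z hz)).continuousAt.continuousWithinAt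
  have hinv : ∀ k : ℕ, ContinuousOn (fun z => ((z * exp (-c z)) ^ k)⁻¹) (sphere 0 ρ) := fun k =>
    ContinuousOn.inv₀ (by fun_prop) fun z hz => pow_ne_zero _ (mul_exp_neg_ne_zero (hne z hz))
  have hcont2 : ContinuousOn (fun z => G z *
      (exp (-c z) * (1 - z * deriv c z) * ((z * exp (-c z)) ^ (n + 1))⁻¹)) (sphere 0 ρ) := by
    have := hG.continuous
    have := hinv (n + 1)
    fun_prop
  have hcont3 : ContinuousOn (fun z => (n : ℂ) * (G z *
      (exp (-c z) * (1 - z * deriv c z) * ((z * exp (-c z)) ^ (n + 1))⁻¹))) (sphere 0 ρ) :=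
    continuousOn_const.mul hcont2
  have hparts : (∮ z in C(0, ρ), deriv G z * ((z * exp (-c z)) ^ n)⁻¹) = n * ∮ z in C(0, ρ),
      G z * (exp (-c z) * (1 - z * deriv c z) * ((z * exp (-c z)) ^ (n + 1))⁻¹) := by
    rw [← sub_eq_zero, ← circleIntegral.integral_const_mul, ← circleIntegral.integral_sub
      (hcont1.circleIntegrable hρ.le) (hcont3.circleIntegrable hρ.le)]
    refine circleIntegral.integral_eq_zero_of_hasDerivWithinAt
      (f := fun z => G z * ((z * exp (-c z)) ^ n)⁻¹) hρ.le fun z hz => ?_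
    have hg := mul_exp_neg_ne_zero (c := c) (hne z hz)
    refine ((hG z).hasDerivAt.mul (((hasDerivAt_mul_exp_neg hc z).pow n).inv
      (pow_ne_zero n hg))).hasDerivWithinAt.congr_deriv ?_
    rcases n with _ | m
    · simp
    simp only [add_tsub_cancel_right, Pi.pow_apply, Pi.inv_apply]
    generalize z * exp (-c z) = g at hg ⊢
    field_simp
    ring
  have hexp : (∮ z in C(0, ρ),
      G z * (exp (-c z) * (1 - z * deriv c z) * ((z * exp (-c z)) ^ (n + 1))⁻¹)) =
      ∮ z in C(0, ρ), ((∑ i ∈ Finset.range (n + 1), p i / i.factorial *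
        (exp (-c z) * (1 - z * deriv c z) * ((z * exp (-c z)) ^ (n - i + 1))⁻¹)) +
        Q (z * exp (-c z)) * (exp (-c z) * (1 - z * deriv c z))) := by
    refine circleIntegral.integral_congr hρ.le fun z hz => ?_
    have hg := mul_exp_neg_ne_zero (c := c) (hne z hz)
    obtain ⟨h1, h2, -⟩ := hball z (hsub (sphere_subset_closedBall hz))
    rw [h1] at h2
    rw [h2, add_mul, Finset.sum_mul]
    congr 1
    · refine Finset.sum_congr rfl fun i hi => ?_
      have hi' : n + 1 = i + (n - i + 1) := by have := Finset.mem_range.1 hi; omega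
      generalize z * exp (-c z) = g at hg ⊢
      rw [hi', pow_add, smul_eq_mul]
      simp only [hp]
      field_simp
    · rw [smul_eq_mul]
      generalize z * exp (-c z) = g at hg ⊢
      field_simp
  have hQd : ∀ z ∈ closedBall (0 : ℂ) ρ, DifferentiableAt ℂ
      (fun z => Q (z * exp (-c z)) * (exp (-c z) * (1 - z * deriv c z))) z := by
    intro z hz
    have hgz := (hasDerivAt_mul_exp_neg hc z).differentiableAt
    have h1 : DifferentiableAt ℂ (fun z => Q (z * exp (-c z))) z :=
      DifferentiableAt.comp z (g := Q) (hball z (hsub hz)).2.2.differentiableAt hgz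
    have h2 : DifferentiableAt ℂ (deriv c) z := hc.contDiff.differentiable_deriv_two z
    have h3 := hc z
    exact h1.mul (by fun_prop)
  have hterm : ∀ i ∈ Finset.range (n + 1), CircleIntegrable (fun z => p i / i.factorial *
      (exp (-c z) * (1 - z * deriv c z) * ((z * exp (-c z)) ^ (n - i + 1))⁻¹)) 0 ρ := by
    intro i _
    refine ContinuousOn.circleIntegrable hρ.le ?_
    have := hinv (n - i + 1)
    fun_prop
  rw [hparts, hexp, circleIntegral.integral_add (CircleIntegrable.fun_sum _ hterm)
    (ContinuousOn.circleIntegrable hρ.le fun z hz =>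
      (hQd z (sphere_subset_closedBall hz)).continuousAt.continuousWithinAt),
    circleIntegral_eq_zero_of_differentiable_on_off_countable hρ.le Set.countable_empty
      (fun z hz => (hQd z hz).continuousAt.continuousWithinAt)
      (fun z hz => hQd z (ball_subset_closedBall hz.1)),
    circleIntegral.integral_fun_sum hterm]
  simp_rw [circleIntegral.integral_const_mul, circleIntegral_deriv_mul_inv_pow hc hρ]
  rw [Finset.sum_range_succ, Finset.sum_eq_zero]
  · simp
    ring
  · intro i hi
    have := Finset.mem_range.1 hi
    rw [if_neg (by omega), mul_zero]

end Lagrange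

section ForestIntegral

open Complex

/-- The generating function of forests with a marked vertex. -/
noncomputable def genMarked (u z : ℂ) : ℂ := genRooted u z * exp (genTree u z)

theorem forestWeight_eq_circleIntegral {V : Type*} [Fintype V] (u : ℂ) (S : Finset V) {r : ℝ}
    (hr : 0 < r) :
    (∮ z in C(0, r), deriv (genMarked u) z * ((z * exp (-genOut u z)) ^ S.card)⁻¹) =
      2 * Real.pi * I * S.card ^ 2 / S.card.factorial * forestWeight u S := by
  have hc : Differentiable ℂ (genOut u) := by
    unfold genOut genIn
    fun_prop
  have hG : Differentiable ℂ (genMarked u) := by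
    unfold genMarked genRooted genTree genOut genIn
    fun_prop
  have hg := hasDerivAt_mul_exp_neg hc 0
  have hga : AnalyticAt ℂ (fun z => z * exp (-genOut u z)) 0 :=
    analyticAt_id.mul (analyticAt_genOut u analyticAt_id).neg.cexp'
  obtain ⟨d, hd, hd0, hdg, hgd⟩ := exists_analytic_inverse hga (by simp)
    (by rw [hg.deriv]; simp)
  have hdx : ∀ᶠ x in 𝓝 0, d x = x * exp (genOut u (d x)) := by
    filter_upwards [hgd] with x hx
    conv_rhs => rw [← hx, mul_assoc, ← exp_add]
    rw [hx]
    simp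
  have hGd : AnalyticAt ℂ (fun x => genMarked u (d x)) 0 :=
    ((analyticAt_genIn u hd).add (analyticAt_genOut u hd)).mul (analyticAt_genTree u hd).cexp'
  rw [circleIntegral_lagrange hc hG hGd hdg _ hr]
  have := card_mul_forestWeight_eq_iteratedDeriv hd hdx S
  simp only [genMarked]
  rw [← this]
  ring

end ForestIntegral

section Domination

lemma one_sub_cos_sub_le (x y : ℝ) :
    1 - Real.cos (y - x) ≤ 2 * ((1 - Real.cos x) + (1 - Real.cos y)) := by
  rw [Real.cos_sub]
  have h1 := Real.sin_sq_add_cos_sq x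
  have h2 := Real.sin_sq_add_cos_sq y
  have h3 := Real.cos_le_one x
  have h4 := Real.cos_le_one y
  have h5 := Real.neg_one_le_cos x
  have h6 := Real.neg_one_le_cos y
  nlinarith [sq_nonneg (Real.sin x + Real.sin y), mul_nonneg (sub_nonneg.2 h3) (sub_nonneg.2 h4),
    sq_nonneg (Real.cos x + Real.cos y - 2), sq_nonneg (Real.cos x - Real.cos y)]

lemma mul_sq_le_one_sub_cos {θ : ℝ} (hθ : |θ| ≤ Real.pi) :
    2 * θ ^ 2 / Real.pi ^ 2 ≤ 1 - Real.cos θ := by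
  have h := Real.mul_abs_le_abs_sin (x := θ / 2) (by
    rw [abs_div, abs_two]
    linarith)
  have h2 : Real.cos θ = 1 - 2 * Real.sin (θ / 2) ^ 2 := by
    have := Real.sin_sq_add_cos_sq (θ / 2)
    have e : θ = 2 * (θ / 2) := by ring
    conv_lhs => rw [e, Real.cos_two_mul]
    linarith
  have h3 : (2 / Real.pi * |θ / 2|) ^ 2 ≤ Real.sin (θ / 2) ^ 2 := by
    rw [← sq_abs (Real.sin _)]
    gcongr
  rw [mul_pow, sq_abs] at h3
  rw [h2]
  have e : 2 * θ ^ 2 / Real.pi ^ 2 = 2 * ((2 / Real.pi) ^ 2 * (θ / 2) ^ 2) := by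
    ring
  rw [e]
  linarith

lemma exp_sub_id_mono {x y : ℝ} (hx : 0 ≤ x) (hxy : x ≤ y) :
    Real.exp x - 1 - x ≤ Real.exp y - 1 - y := by
  have h1 := Real.add_one_le_exp (y - x)
  have h2 := Real.one_le_exp hx
  have h3 : Real.exp y = Real.exp x * Real.exp (y - x) := by
    rw [← Real.exp_add]
    ring_nf
  nlinarith

lemma norm_exp_sub_one_sub_id_le (z : ℂ) : ‖Complex.exp z - 1 - z‖ ≤ Real.exp ‖z‖ - 1 - ‖z‖ := by
  have := Complex.norm_exp_sub_sum_le_exp_norm_sub_sum z 2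
  simpa [Finset.sum_range_succ, sub_sub] using this

lemma re_exp_mul_pow (w : ℂ) (r θ : ℝ) (k : ℕ) :
    (Complex.exp w * (r * Complex.exp (θ * Complex.I)) ^ k).re =
      Real.exp w.re * r ^ k * Real.cos (w.im + k * θ) := by
  rw [mul_pow, ← Complex.exp_nat_mul, mul_left_comm, ← Complex.exp_add, ← Complex.ofReal_pow,
    Complex.re_ofReal_mul, Complex.exp_re]
  simp
  ring

lemma re_genOut_le {r : ℝ} (hr0 : 0 < r) (hr1 : r ≤ 1) (w : ℂ) {θ : ℝ} (hθ : |θ| ≤ Real.pi) :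
    (genOut (Complex.exp w) (r * Complex.exp (θ * Complex.I))).re ≤
      (genOut (Complex.exp w.re) r).re - Real.exp w.re * r ^ 3 * θ ^ 2 / Real.pi ^ 2 := by
  set u := Complex.exp w with hu
  set z : ℂ := r * Complex.exp (θ * Complex.I) with hz
  set ρ := Real.exp w.re with hρ
  have hρ0 : 0 < ρ := Real.exp_pos _
  have hnu : ‖u‖ = ρ := Complex.norm_exp w
  have hnz : ‖z‖ = r := by
    rw [hz, norm_mul, Complex.norm_exp_ofReal_mul_I, mul_one, Complex.norm_real,
      Real.norm_of_nonneg hr0.le]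
  have hdec : genOut u z = u * z ^ 2 + u * z ^ 3 +
      (z * (Complex.exp (genIn u z) - 1 - genIn u z) +
        u * z ^ 2 * (Complex.exp z - 1 - z)) := by
    rw [genOut]
    have : genIn u z = u * z * Complex.exp z := rfl
    linear_combination z * this
  have hreal : (genOut (Complex.exp w.re) r).re = r * (Real.exp (ρ * r * Real.exp r) - 1) := by
    rw [genOut, genIn, ← Complex.ofReal_exp, ← Complex.ofReal_exp, ← hρ, ← Complex.ofReal_mul,
      ← Complex.ofReal_mul, ← Complex.ofReal_exp, ← Complex.ofReal_one, ← Complex.ofReal_sub,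
      ← Complex.ofReal_mul, Complex.ofReal_re]
  have hexpz : ‖Complex.exp z‖ ≤ Real.exp r := by
    rw [← hnz]
    exact Complex.norm_exp_le_exp_norm z
  have hA : ‖genIn u z‖ ≤ ρ * r * Real.exp r := by
    rw [genIn, norm_mul, norm_mul, hnu, hnz]
    gcongr
  have hR1 : (z * (Complex.exp (genIn u z) - 1 - genIn u z)).re ≤
      r * (Real.exp (ρ * r * Real.exp r) - 1 - ρ * r * Real.exp r) := by
    refine (Complex.re_le_norm _).trans ?_
    rw [norm_mul, hnz]
    gcongr
    exact (norm_exp_sub_one_sub_id_le _).trans (exp_sub_id_mono (norm_nonneg _) hA)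
  have hR2 : (u * z ^ 2 * (Complex.exp z - 1 - z)).re ≤
      ρ * r ^ 2 * (Real.exp r - 1 - r) := by
    refine (Complex.re_le_norm _).trans ?_
    rw [norm_mul, norm_mul, norm_pow, hnu, hnz]
    gcongr
    rw [← hnz]
    exact norm_exp_sub_one_sub_id_le _
  rw [hdec, Complex.add_re, Complex.add_re, Complex.add_re, hreal, hu, hz, re_exp_mul_pow,
    re_exp_mul_pow, ← hz, ← hu]
  have hc := one_sub_cos_sub_le (w.im + (2 : ℕ) * θ) (w.im + (3 : ℕ) * θ)
  have e : w.im + (3 : ℕ) * θ - (w.im + (2 : ℕ) * θ) = θ := by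
    push_cast
    ring
  rw [e] at hc
  have hθ2 := mul_sq_le_one_sub_cos hθ
  have hx := Real.cos_le_one (w.im + (2 : ℕ) * θ)
  set x := Real.cos (w.im + (2 : ℕ) * θ)
  set y := Real.cos (w.im + (3 : ℕ) * θ)
  have h23 : r ^ 3 ≤ r ^ 2 := pow_le_pow_of_le_one hr0.le hr1 (by norm_num)
  have hb : θ ^ 2 / Real.pi ^ 2 ≤ (1 - x) + (1 - y) := by
    have : 2 * θ ^ 2 / Real.pi ^ 2 = 2 * (θ ^ 2 / Real.pi ^ 2) := by ring
    linarith
  have hmain : ρ * r ^ 3 * (θ ^ 2 / Real.pi ^ 2) ≤ ρ * r ^ 2 * (1 - x) + ρ * r ^ 3 * (1 - y) := by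
    have h1 : ρ * r ^ 3 * (θ ^ 2 / Real.pi ^ 2) ≤ ρ * r ^ 3 * ((1 - x) + (1 - y)) := by gcongr
    have h2 : ρ * r ^ 3 * (1 - x) ≤ ρ * r ^ 2 * (1 - x) := by
      have := sub_nonneg.2 hx
      gcongr
    linarith
  have e2 : ρ * r ^ 3 * θ ^ 2 / Real.pi ^ 2 = ρ * r ^ 3 * (θ ^ 2 / Real.pi ^ 2) := by ring
  rw [e2]
  linarith

end Domination

section MarkedDeriv

open Complex

/-- The derivative of `genMarked u`. -/
noncomputable def genMarkedDeriv (u z : ℂ) : ℂ :=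
  let a := genIn u z
  let c := genOut u z
  let a' := a + u * exp z
  let c' := (exp a - 1) + z * (exp a * a')
  (a' + c') * exp (genTree u z) +
    (a + c) * (exp (genTree u z) * (a' + c' - (a' * (c + z) + a * (c' + 1)) - c * c'))

lemma deriv_genMarked (u z : ℂ) : deriv (genMarked u) z = genMarkedDeriv u z := by
  have hA := hasDerivAt_genIn u (hasDerivAt_id z)
  have hC := hasDerivAt_genOut u (hasDerivAt_id z)
  have hCd := hC.add (hasDerivAt_id z)
  have hT := ((hA.add hC).sub (hA.mul hCd)).sub ((hC.pow 2).div_const 2)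
  refine HasDerivAt.deriv (((hA.add hC).mul hT.cexp).congr_deriv ?_)
  simp only [genMarkedDeriv, Pi.add_apply, Pi.sub_apply, Pi.mul_apply, Pi.pow_apply, id, genTree]
  push_cast
  ring

lemma continuous_genMarkedDeriv : Continuous fun p : ℂ × ℂ => genMarkedDeriv p.1 p.2 := by
  unfold genMarkedDeriv genTree genOut genIn
  fun_prop

end MarkedDeriv

section Saddle

/-- `r` is a saddle point of `genOut 1 z - log z` in the interval `(0, 1]`. -/
structure IsSaddle (r : ℝ) : Prop where
  pos : 0 < r
  le_one : r ≤ 1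
  eq_one : r * (Real.exp (r * Real.exp r) - 1) +
    r * (r * Real.exp r) * Real.exp (r * Real.exp r) * (1 + r) = 1

lemma exists_isSaddle : ∃ r, IsSaddle r := by
  have hc : Continuous fun r : ℝ => r * (Real.exp (r * Real.exp r) - 1) +
    r * (r * Real.exp r) * Real.exp (r * Real.exp r) * (1 + r) := by fun_prop
  have h1 : (1 : ℝ) ∈ Set.Icc ((fun r : ℝ => r * (Real.exp (r * Real.exp r) - 1) +
    r * (r * Real.exp r) * Real.exp (r * Real.exp r) * (1 + r)) 0)
    ((fun r : ℝ => r * (Real.exp (r * Real.exp r) - 1) +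
    r * (r * Real.exp r) * Real.exp (r * Real.exp r) * (1 + r)) 1) := by
    constructor
    · simp
    · simp only [one_mul]
      have h := Real.add_one_le_exp 1
      have h2 := Real.add_one_le_exp (Real.exp 1)
      nlinarith
  obtain ⟨r, hr, h⟩ := intermediate_value_Icc zero_le_one hc.continuousOn h1
  refine ⟨r, lt_of_le_of_ne hr.1 ?_, hr.2, h⟩
  rintro rfl
  simp at h

variable {r : ℝ} (hr : IsSaddle r)

include hr

lemma IsSaddle.genMarkedDeriv_ne_zero : genMarkedDeriv 1 r ≠ 0 := by
  have h0 := hr.pos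
  set a := r * Real.exp r with ha
  have ha0 : 0 < a := mul_pos h0 (Real.exp_pos r)
  have hA : genIn 1 r = (a : ℂ) := by
    rw [genIn, ha]
    push_cast
    ring
  have hC : genOut 1 r = ((r * (Real.exp a - 1) : ℝ) : ℂ) := by
    rw [genOut, hA]
    push_cast
    ring
  set c := r * (Real.exp a - 1) with hc
  have hd : (a + Real.exp r : ℝ) * r = a * (1 + r) := by
    rw [ha]
    ring
  set a' := a + Real.exp r with ha'
  have ha'0 : 0 < a' := add_pos ha0 (Real.exp_pos r)
  set c' := (Real.exp a - 1) + r * (Real.exp a * a') with hc'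
  have hc1 : r * c' = 1 := by
    have := hr.eq_one
    rw [← ha] at this
    linear_combination this + r * Real.exp a * hd
  have hc'0 : 0 < c' := by
    by_contra hneg
    nlinarith
  have hk : a' + c' - (a' * (c + r) + a * (c' + 1)) - c * c' = 0 := by
    have : r * (a' + c' - (a' * (c + r) + a * (c' + 1)) - c * c') = 0 := by
      have := hr.eq_one
      rw [← ha] at this
      linear_combination (1 - c - r) * hd + (1 - a - c) * hc1 - this - (1 + a * (1 + r)) * hc
    exact (mul_eq_zero.1 this).resolve_left h0.ne'
  have key : genMarkedDeriv 1 r = ((a' + c' : ℝ) : ℂ) * Complex.exp (genTree 1 r) := by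
    have hk' : ((a' + c' - (a' * (c + r) + a * (c' + 1)) - c * c' : ℝ) : ℂ) = 0 := by
      rw [hk, Complex.ofReal_zero]
    have e1 : genIn 1 r + 1 * Complex.exp r = (a' : ℂ) := by
      rw [hA, ha']
      push_cast
      ring
    have e2 : (Complex.exp (genIn 1 r) - 1) + r * (Complex.exp (genIn 1 r) * a') = (c' : ℂ) := by
      rw [hA, hc']
      push_cast
      ring
    simp only [genMarkedDeriv]
    rw [e1, e2, hA, hC]
    push_cast at hk' ⊢
    rw [hk']
    ring
  rw [key]
  refine mul_ne_zero ?_ (Complex.exp_ne_zero _)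
  exact_mod_cast (add_pos ha'0 hc'0).ne'

end Saddle

section RealIntegral

open Complex

/-- The integrand of the integral representation of `forestWeight` on a circle of radius `r`. -/
noncomputable def angularIntegrand (r : ℝ) (n : ℕ) (u : ℂ) (θ : ℝ) : ℂ :=
  r * exp (θ * I) * genMarkedDeriv u (r * exp (θ * I)) *
    exp (n * (genOut u (r * exp (θ * I)) - θ * I))

lemma angularIntegrand_periodic (r : ℝ) (n : ℕ) (u : ℂ) :
    Function.Periodic (angularIntegrand r n u) (2 * Real.pi) := by
  intro θ
  have h1 : exp (((θ + 2 * Real.pi : ℝ) : ℂ) * I) = exp (θ * I) := by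
    push_cast
    rw [add_mul]
    exact exp_periodic _
  have h2 : exp (n * (genOut u (r * exp (θ * I)) - ((θ + 2 * Real.pi : ℝ) : ℂ) * I)) =
      exp (n * (genOut u (r * exp (θ * I)) - θ * I)) := by
    rw [exp_nat_mul, exp_nat_mul, exp_sub, exp_sub, h1]
  rw [angularIntegrand, h1, h2, angularIntegrand]

lemma forestWeight_eq_integral {V : Type*} [Fintype V] (u : ℂ) (S : Finset V) {r : ℝ}
    (hr : 0 < r) (hS : 0 < S.card) :
    forestWeight u S = S.card.factorial / (2 * Real.pi * S.card ^ 2) * ((r : ℂ) ^ S.card)⁻¹ *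
      ∫ θ in (-Real.pi)..Real.pi, angularIntegrand r S.card u θ := by
  have h := forestWeight_eq_circleIntegral u S hr
  have e : ∀ θ : ℝ, deriv (circleMap 0 r) θ • (deriv (genMarked u) (circleMap 0 r θ) *
      ((circleMap 0 r θ * exp (-genOut u (circleMap 0 r θ))) ^ S.card)⁻¹) =
      I * ((r : ℂ) ^ S.card)⁻¹ * angularIntegrand r S.card u θ := by
    intro θ
    rw [deriv_circleMap, deriv_genMarked, angularIntegrand, circleMap, zero_add, exp_nat_mul,
      exp_sub, exp_neg, smul_eq_mul, mul_pow, mul_pow, div_pow, inv_pow]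
    field_simp
  rw [circleIntegral] at h
  simp_rw [e] at h
  rw [intervalIntegral.integral_const_mul] at h
  have hp := (angularIntegrand_periodic r S.card u).intervalIntegral_add_eq (-Real.pi) 0
  rw [zero_add, show -Real.pi + 2 * Real.pi = Real.pi by ring] at hp
  rw [hp]
  have hn : (S.card : ℂ) ≠ 0 := by exact_mod_cast hS.ne'
  have hf : (S.card.factorial : ℂ) ≠ 0 := by exact_mod_cast S.card.factorial_ne_zero
  have hpi : (Real.pi : ℂ) ≠ 0 := by exact_mod_cast Real.pi_ne_zero
  set J := ∫ θ in (0 : ℝ)..2 * Real.pi, angularIntegrand r S.card u θ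
  have h2 : ((r : ℂ) ^ S.card)⁻¹ * J = 2 * Real.pi * S.card ^ 2 / S.card.factorial *
      forestWeight u S := by
    refine mul_left_cancel₀ I_ne_zero ?_
    linear_combination h
  rw [mul_assoc, h2]
  field_simp

end RealIntegral

section SecondOrder

lemma tendsto_taylor_two {f f' : ℂ → ℂ} {c : ℂ} (hf : ∀ z, HasDerivAt f (f' z) z)
    (hf' : HasDerivAt f' c 0) :
    Tendsto (fun z => (f z - f 0 - z * f' 0) / z ^ 2) (𝓝[≠] 0) (𝓝 (c / 2)) := by
  have ha : AnalyticAt ℂ f 0 :=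
    (show Differentiable ℂ f from fun z => (hf z).differentiableAt).analyticAt 0
  obtain ⟨F, hF, h⟩ := ha.exists_eventuallyEq_sum_add_pow_mul 3
  have hd : deriv f = f' := funext fun z => (hf z).deriv
  have hlim : Tendsto (fun z => c / 2 + z * F z) (𝓝[≠] 0) (𝓝 (c / 2)) := by
    have : ContinuousAt (fun z => c / 2 + z * F z) 0 := by
      have := hF.continuousAt
      fun_prop
    have h2 := this.tendsto.mono_left (nhdsWithin_le_nhds (s := {0}ᶜ))
    simpa using h2
  refine hlim.congr' ?_
  filter_upwards [h.filter_mono nhdsWithin_le_nhds, self_mem_nhdsWithin] with z hz hz0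
  have hz0' : z ≠ 0 := hz0
  have h2 : iteratedDeriv 2 f 0 = c := by
    rw [iteratedDeriv_succ, iteratedDeriv_one, hd, hf'.deriv]
  simp only [Finset.sum_range_succ, Finset.sum_range_zero, iteratedDeriv_zero, iteratedDeriv_one,
    h2, hd] at hz
  rw [hz]
  norm_num
  field_simp
  ring

end SecondOrder

section LocalExpansion

open Complex

/-- The limit of the mean proportion of vertices in the independent set, in terms of the saddle
point `r`. -/
noncomputable def saddleMean (r : ℝ) : ℝ := r * (r * Real.exp r) * Real.exp (r * Real.exp r)

/-- The second derivative at `0` of `t ↦ genOut (exp (t * s)) (r * exp (t * w))`. -/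
noncomputable def saddleHess (r : ℝ) (s w : ℂ) : ℂ :=
  w ^ 2 * ((r * (Real.exp (r * Real.exp r) - 1) : ℝ) : ℂ) +
    2 * saddleMean r * w * (s + (1 + r) * w) +
    saddleMean r * (1 + r * Real.exp r : ℝ) * (s + (1 + r) * w) ^ 2 + saddleMean r * w ^ 2 * r

lemma tendsto_genOut_taylor {r : ℝ} (hr : IsSaddle r) (s w : ℂ) :
    Tendsto (fun t : ℂ => (genOut (exp (t * s)) (r * exp (t * w)) - genOut 1 r -
      t * (w + saddleMean r * s)) / t ^ 2) (𝓝[≠] 0) (𝓝 (saddleHess r s w / 2)) := by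
  have hz : ∀ t : ℂ, HasDerivAt (fun t => (r : ℂ) * exp (t * w)) (w * (r * exp (t * w))) t := by
    intro t
    refine (((hasDerivAt_mul_const w).cexp).const_mul (r : ℂ)).congr_deriv ?_
    ring
  have hu : ∀ t : ℂ, HasDerivAt (fun t => exp (t * s)) (s * exp (t * s)) t := by
    intro t
    refine ((hasDerivAt_mul_const s).cexp).congr_deriv ?_
    ring
  have hA : ∀ t : ℂ, HasDerivAt (fun t => genIn (exp (t * s)) (r * exp (t * w)))
      (genIn (exp (t * s)) (r * exp (t * w)) * (s + w + w * (r * exp (t * w)))) t := by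
    intro t
    refine (((hu t).mul (hz t)).mul (hz t).cexp).congr_deriv ?_
    simp only [genIn, Pi.mul_apply]
    ring
  have hC : ∀ t : ℂ, HasDerivAt (fun t => genOut (exp (t * s)) (r * exp (t * w)))
      (w * (r * exp (t * w)) * (exp (genIn (exp (t * s)) (r * exp (t * w))) - 1) +
        r * exp (t * w) * exp (genIn (exp (t * s)) (r * exp (t * w))) *
        genIn (exp (t * s)) (r * exp (t * w)) * (s + w + w * (r * exp (t * w)))) t := by
    intro t
    refine ((hz t).mul ((hA t).cexp.sub_const 1)).congr_deriv ?_
    ring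
  have hA0 : genIn 1 r = ((r * Real.exp r : ℝ) : ℂ) := by
    rw [genIn]
    push_cast
    ring
  have h := tendsto_taylor_two hC (c := saddleHess r s w) ?_
  · simp only [zero_mul, exp_zero, mul_one, hA0] at h
    have e : w * r * (exp (r * Real.exp r : ℝ) - 1) + r * exp (r * Real.exp r : ℝ) *
        (r * Real.exp r : ℝ) * (s + w + w * r) = w + saddleMean r * s := by
      have := congrArg (fun x : ℝ => (x : ℂ)) hr.eq_one
      push_cast at this
      rw [saddleMean]
      push_cast
      linear_combination w * this
    rwa [e] at h
  · have hcz := (hz 0).const_mul w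
    have h1 := hcz.mul ((hA 0).cexp.sub_const 1)
    have h2 := (((hz 0).mul (hA 0).cexp).mul (hA 0)).mul (hcz.const_add (s + w))
    refine (h1.add h2).congr_deriv ?_
    simp only [zero_mul, exp_zero, mul_one, hA0, Pi.mul_apply, saddleHess, saddleMean]
    push_cast
    ring

/-- The exponent of the integral representation of `forestWeight`, recentered at the saddle point
and rescaled. -/
noncomputable def localExponent (r : ℝ) (n : ℕ) (s : ℂ) (v : ℝ) : ℂ :=
  n * (genOut (exp (((√n)⁻¹ : ℝ) * s)) (r * exp (((√n)⁻¹ : ℝ) * (v * I))) - genOut 1 r) -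
    (√n : ℝ) * (v * I + saddleMean r * s)

lemma tendsto_inv_sqrt_nat : Tendsto (fun n : ℕ => (√(n : ℝ))⁻¹) atTop (𝓝 0) :=
  (Real.tendsto_sqrt_atTop.comp tendsto_natCast_atTop_atTop).inv_tendsto_atTop

lemma tendsto_ofReal_inv_sqrt_nat :
    Tendsto (fun n : ℕ => (((√(n : ℝ))⁻¹ : ℝ) : ℂ)) atTop (𝓝[≠] 0) := by
  refine tendsto_nhdsWithin_iff.2 ⟨?_, ?_⟩
  · have := (continuous_ofReal.tendsto 0).comp tendsto_inv_sqrt_nat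
    simpa only [Function.comp_def, ofReal_zero] using this
  · filter_upwards [eventually_gt_atTop 0] with n hn
    have : 0 < √(n : ℝ) := Real.sqrt_pos.2 (by exact_mod_cast hn)
    simpa using this.ne'

lemma tendsto_localExponent {r : ℝ} (hr : IsSaddle r) (s : ℂ) (v : ℝ) :
    Tendsto (fun n => localExponent r n s v) atTop (𝓝 (saddleHess r s (v * I) / 2)) := by
  refine ((tendsto_genOut_taylor hr s (v * I)).comp tendsto_ofReal_inv_sqrt_nat).congr' ?_
  filter_upwards [eventually_gt_atTop 0] with n hn
  have h0 : 0 < √(n : ℝ) := Real.sqrt_pos.2 (by exact_mod_cast hn)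
  have h1 : ((√(n : ℝ) : ℝ) : ℂ) ≠ 0 := by exact_mod_cast h0.ne'
  have h2 : (n : ℂ) = ((√(n : ℝ) : ℝ) : ℂ) ^ 2 := by
    rw [← ofReal_pow, Real.sq_sqrt (by positivity), ofReal_natCast]
  rw [localExponent, h2]
  simp only [Function.comp, ofReal_inv]
  field_simp

lemma re_localExponent_le {r : ℝ} (hr : IsSaddle r) {n : ℕ} (hn : 0 < n) (s : ℂ) {v : ℝ}
    (hv : |v| ≤ Real.pi * √n) :
    (localExponent r n s v).re ≤ (localExponent r n (s.re : ℝ) 0).re -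
      Real.exp (-|s.re|) * r ^ 3 / Real.pi ^ 2 * v ^ 2 := by
  have hn' : (1 : ℝ) ≤ n := by exact_mod_cast hn
  have h0 : 1 ≤ √(n : ℝ) := Real.one_le_sqrt.2 hn'
  have hs2 : √(n : ℝ) ^ 2 = n := Real.sq_sqrt (by positivity)
  have h := re_genOut_le hr.pos hr.le_one (((√n)⁻¹ : ℝ) * s) (θ := (√n)⁻¹ * v) (by
    rw [abs_mul, abs_inv, abs_of_pos (by linarith : 0 < √(n : ℝ)), inv_mul_le_iff₀ (by linarith)]
    linarith)
  rw [re_ofReal_mul] at h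
  have hexp : Real.exp (-|s.re|) ≤ Real.exp ((√n)⁻¹ * s.re) := by
    rw [Real.exp_le_exp]
    refine neg_le_of_abs_le ?_
    rw [abs_mul, abs_inv, abs_of_pos (by linarith : 0 < √(n : ℝ))]
    exact mul_le_of_le_one_left (abs_nonneg _) (inv_le_one_of_one_le₀ h0)
  have hl : (localExponent r n s v).re =
      n * ((genOut (exp (((√n)⁻¹ : ℝ) * s)) (r * exp (((√n)⁻¹ * v : ℝ) * I))).re -
        (genOut 1 r).re) - √n * (saddleMean r * s.re) := by
    have e : (((√n)⁻¹ : ℝ) : ℂ) * (v * I) = ((√n)⁻¹ * v : ℝ) * I := by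
      push_cast
      ring
    rw [localExponent, e, sub_re, ← ofReal_natCast, re_ofReal_mul, re_ofReal_mul, sub_re]
    simp
  have hr' : (localExponent r n (s.re : ℝ) 0).re =
      n * ((genOut (exp ((√n)⁻¹ * s.re : ℝ)) r).re -
        (genOut 1 r).re) - √n * (saddleMean r * s.re) := by
    rw [localExponent, sub_re, ← ofReal_natCast, re_ofReal_mul, re_ofReal_mul, sub_re]
    simp
  rw [hl, hr']
  have h3 : Real.exp (-|s.re|) * r ^ 3 / Real.pi ^ 2 * v ^ 2 ≤
      n * (Real.exp ((√n)⁻¹ * s.re) * r ^ 3 * ((√n)⁻¹ * v) ^ 2 / Real.pi ^ 2) := by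
    have e : n * (Real.exp ((√n)⁻¹ * s.re) * r ^ 3 * ((√n)⁻¹ * v) ^ 2 / Real.pi ^ 2) =
        Real.exp ((√n)⁻¹ * s.re) * r ^ 3 / Real.pi ^ 2 * v ^ 2 := by
      rw [← hs2]
      have : √(n : ℝ) ≠ 0 := by linarith
      field_simp
      rw [Real.sqrt_sq (by linarith)]
    rw [e]
    have := hr.pos
    gcongr
  have h4 := mul_le_mul_of_nonneg_left h (by linarith : (0 : ℝ) ≤ n)
  linarith

end LocalExpansion

section GaussianIntegral

open Complex

/-- The coefficient of `s ^ 2` in `saddleHess r s w`. -/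
noncomputable def hessLeft (r : ℝ) : ℝ := saddleMean r * (1 + r * Real.exp r)

/-- Half of the coefficient of `s * w` in `saddleHess r s w`. -/
noncomputable def hessMid (r : ℝ) : ℝ := saddleMean r + (1 + r) * hessLeft r

/-- The coefficient of `w ^ 2` in `saddleHess r s w`. -/
noncomputable def hessRight (r : ℝ) : ℝ :=
  r * (Real.exp (r * Real.exp r) - 1) + 2 * (1 + r) * saddleMean r + (1 + r) ^ 2 * hessLeft r +
    saddleMean r * r

/-- The limit of the variance of the size of the independent set divided by the number of
vertices, in terms of the saddle point `r`. -/
noncomputable def saddleVar (r : ℝ) : ℝ := hessLeft r - hessMid r ^ 2 / hessRight r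

lemma saddleHess_eq (r : ℝ) (s w : ℂ) :
    saddleHess r s w = hessLeft r * s ^ 2 + 2 * hessMid r * s * w + hessRight r * w ^ 2 := by
  simp only [saddleHess, hessLeft, hessMid, hessRight]
  push_cast
  ring

lemma saddleMean_pos {r : ℝ} (h0 : 0 < r) : 0 < saddleMean r := by
  unfold saddleMean
  positivity

lemma hessRight_pos {r : ℝ} (h0 : 0 < r) : 0 < hessRight r := by
  have := saddleMean_pos h0
  have h1 : 0 < Real.exp (r * Real.exp r) - 1 := by
    rw [sub_pos]
    exact Real.one_lt_exp_iff.2 (by positivity)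
  unfold hessRight hessLeft
  positivity

lemma saddleVar_pos {r : ℝ} (h0 : 0 < r) : 0 < saddleVar r := by
  rw [saddleVar, sub_pos, div_lt_iff₀ (hessRight_pos h0)]
  have hQ := saddleMean_pos h0
  have ha : 0 < r * Real.exp r := by positivity
  have he := Real.add_one_lt_exp ha.ne'
  have e : hessLeft r * hessRight r - hessMid r ^ 2 = saddleMean r * r *
      ((Real.exp (r * Real.exp r) - (r * Real.exp r + 1)) +
        (1 + r * Real.exp r) * (r * (r * Real.exp r) * Real.exp (r * Real.exp r))) := by
    simp only [hessMid, hessRight, hessLeft, saddleMean]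
    ring
  have h1 := sub_pos.2 he
  have : 0 < hessLeft r * hessRight r - hessMid r ^ 2 := by
    rw [e]
    positivity
  linarith

lemma integral_exp_saddleHess {r : ℝ} (h0 : 0 < r) (s : ℂ) :
    ∫ v : ℝ, exp (saddleHess r s (v * I) / 2) =
      (2 * Real.pi / hessRight r : ℂ) ^ (1 / 2 : ℂ) * exp (saddleVar r * s ^ 2 / 2) := by
  have hγ := hessRight_pos h0
  have hγ' : (hessRight r : ℂ) ≠ 0 := by exact_mod_cast hγ.ne'
  have h := integral_cexp_quadratic (b := -(hessRight r / 2 : ℝ)) (by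
    rw [neg_re, ofReal_re]
    linarith) (hessMid r * s * I) (hessLeft r * s ^ 2 / 2)
  have e1 : ∀ v : ℝ, saddleHess r s (v * I) / 2 = -(hessRight r / 2 : ℝ) * (v : ℂ) ^ 2 +
      hessMid r * s * I * v + hessLeft r * s ^ 2 / 2 := by
    intro v
    rw [saddleHess_eq, mul_pow, I_sq]
    push_cast
    ring
  simp_rw [e1]
  rw [h]
  congr 2
  · push_cast
    field_simp
  · rw [saddleVar, mul_pow, I_sq]
    push_cast
    field_simp
    ring

end GaussianIntegral

section Laplace

open Complex

/-- The integrand of the recentered and rescaled integral representation of `forestWeight`. -/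
noncomputable def laplaceIntegrand (r : ℝ) (n : ℕ) (s : ℂ) : ℝ → ℂ :=
  (Set.Ioc (-(Real.pi * √n)) (Real.pi * √n)).indicator fun v =>
    r * exp (((√n)⁻¹ : ℝ) * (v * I)) *
      genMarkedDeriv (exp (((√n)⁻¹ : ℝ) * s)) (r * exp (((√n)⁻¹ : ℝ) * (v * I))) *
      exp (localExponent r n s v)

lemma forestWeight_eq_laplace {V : Type*} [Fintype V] (S : Finset V) {r : ℝ} (hr : 0 < r)
    (hS : 0 < S.card) (s : ℂ) :
    forestWeight (exp (((√S.card)⁻¹ : ℝ) * s)) S =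
      (S.card.factorial / (2 * Real.pi * S.card ^ 2) * ((r : ℂ) ^ S.card)⁻¹ *
        (((√S.card)⁻¹ : ℝ) * exp (S.card * genOut 1 r))) *
      exp ((√S.card : ℝ) * saddleMean r * s) * ∫ v, laplaceIntegrand r S.card s v := by
  rw [forestWeight_eq_integral _ S hr hS]
  set n := S.card
  have hn : (0 : ℝ) < n := by exact_mod_cast hS
  have h0 : 0 < √(n : ℝ) := Real.sqrt_pos.2 hn
  have h1 : ((√(n : ℝ) : ℝ) : ℂ) ≠ 0 := by exact_mod_cast h0.ne'
  have h2 : (n : ℂ) = ((√(n : ℝ) : ℝ) : ℂ) ^ 2 := by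
    rw [← ofReal_pow, Real.sq_sqrt (by positivity), ofReal_natCast]
  have hcomp := intervalIntegral.integral_comp_mul_left
    (angularIntegrand r n (exp (((√n)⁻¹ : ℝ) * s))) (inv_ne_zero h0.ne')
    (a := -(Real.pi * √n)) (b := Real.pi * √n)
  have hb : (√(n : ℝ))⁻¹ * (Real.pi * √n) = Real.pi := by field_simp
  rw [mul_neg, hb, inv_inv] at hcomp
  have e : ∀ v : ℝ, angularIntegrand r n (exp (((√n)⁻¹ : ℝ) * s)) ((√n)⁻¹ * v) =
      exp (n * genOut 1 r) * exp ((√n : ℝ) * saddleMean r * s) *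
      (r * exp (((√n)⁻¹ : ℝ) * (v * I)) *
      genMarkedDeriv (exp (((√n)⁻¹ : ℝ) * s)) (r * exp (((√n)⁻¹ : ℝ) * (v * I))) *
      exp (localExponent r n s v)) := by
    intro v
    have e1 : (((√n)⁻¹ * v : ℝ) : ℂ) * I = ((√n)⁻¹ : ℝ) * (v * I) := by
      push_cast
      ring
    rw [angularIntegrand, e1, mul_left_comm _ (_ * _) (exp _), ← exp_add, ← exp_add]
    congr 2
    rw [localExponent, h2]
    push_cast
    field_simp
    ring
  simp_rw [e] at hcomp
  rw [intervalIntegral.integral_const_mul] at hcomp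
  have hL : ∫ v, laplaceIntegrand r n s v = ∫ v in (-(Real.pi * √n))..(Real.pi * √n),
      (r * exp (((√n)⁻¹ : ℝ) * (v * I)) *
      genMarkedDeriv (exp (((√n)⁻¹ : ℝ) * s)) (r * exp (((√n)⁻¹ : ℝ) * (v * I))) *
      exp (localExponent r n s v)) := by
    rw [laplaceIntegrand, integral_indicator measurableSet_Ioc,
      intervalIntegral.integral_of_le (by nlinarith [Real.pi_pos])]
  rw [hL]
  rw [real_smul] at hcomp
  have := congrArg (fun x => (((√n)⁻¹ : ℝ) : ℂ) * x) hcomp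
  simp only [ofReal_inv] at this ⊢
  rw [inv_mul_cancel_left₀ h1] at this
  rw [← this]
  ring

lemma tendsto_integral_laplaceIntegrand {r : ℝ} (hr : IsSaddle r) (s : ℂ) :
    Tendsto (fun n => ∫ v, laplaceIntegrand r n s v) atTop
      (𝓝 (∫ v : ℝ, r * genMarkedDeriv 1 r * exp (saddleHess r s (v * I) / 2))) := by
  obtain ⟨B, hB⟩ : ∃ B, ∀ p ∈ Metric.closedBall (0 : ℂ) (Real.exp ‖s‖) ×ˢ
      Metric.closedBall (0 : ℂ) r, ‖genMarkedDeriv p.1 p.2‖ ≤ B :=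
    ((isCompact_closedBall _ _).prod (isCompact_closedBall _ _)).exists_bound_of_continuousOn
      continuous_genMarkedDeriv.continuousOn
  obtain ⟨K, hK⟩ : ∃ K, ∀ n, (localExponent r n (s.re : ℝ) 0).re ≤ K := by
    have := (continuous_re.tendsto _).comp (tendsto_localExponent hr (s.re : ℝ) 0)
    obtain ⟨K, hK⟩ := this.bddAbove_range
    exact ⟨K, fun n => hK ⟨n, rfl⟩⟩
  have hr0 := hr.pos
  have hκ : 0 < Real.exp (-|s.re|) * r ^ 3 / Real.pi ^ 2 := by positivity
  set κ := Real.exp (-|s.re|) * r ^ 3 / Real.pi ^ 2 with hκd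
  have hB0 : 0 ≤ B := (norm_nonneg _).trans (hB (0, 0)
    ⟨by simpa using (Real.exp_pos _).le, by simpa using hr0.le⟩)
  refine tendsto_integral_filter_of_dominated_convergence
    (fun v => r * B * (Real.exp K * Real.exp (-κ * v ^ 2))) ?_ ?_ ?_ ?_
  · refine Eventually.of_forall fun n => ?_
    refine (Continuous.aestronglyMeasurable ?_).indicator measurableSet_Ioc
    unfold localExponent genMarkedDeriv genTree genOut genIn
    fun_prop
  · filter_upwards [eventually_gt_atTop 0] with n hn
    refine ae_of_all _ fun v => ?_
    have hpos : 0 ≤ r * B * (Real.exp K * Real.exp (-κ * v ^ 2)) := by positivity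
    by_cases hv : v ∈ Set.Ioc (-(Real.pi * √n)) (Real.pi * √n)
    swap
    · rw [laplaceIntegrand, Set.indicator_of_notMem hv, norm_zero]
      exact hpos
    have hv' : |v| ≤ Real.pi * √n := abs_le.2 ⟨hv.1.le, hv.2⟩
    have hre := re_localExponent_le hr hn s hv'
    have h1 : 1 ≤ √(n : ℝ) := Real.one_le_sqrt.2 (by exact_mod_cast hn)
    have hz : ‖(r : ℂ) * exp (((√n)⁻¹ : ℝ) * (v * I))‖ = r := by
      rw [← mul_assoc, ← ofReal_mul, norm_mul, norm_exp_ofReal_mul_I, mul_one, norm_real,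
        Real.norm_of_nonneg hr0.le]
    have hu : ‖exp (((√n)⁻¹ : ℝ) * s)‖ ≤ Real.exp ‖s‖ := by
      refine (norm_exp_le_exp_norm _).trans (Real.exp_le_exp.2 ?_)
      rw [norm_mul, norm_real, Real.norm_of_nonneg (by positivity)]
      exact mul_le_of_le_one_left (norm_nonneg _) (inv_le_one_of_one_le₀ h1)
    have hb := hB (exp (((√n)⁻¹ : ℝ) * s), r * exp (((√n)⁻¹ : ℝ) * (v * I)))
      ⟨by simpa using hu, by simpa using hz.le⟩
    rw [laplaceIntegrand, Set.indicator_of_mem hv, norm_mul, norm_mul, hz, norm_exp, ← Real.exp_add]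
    gcongr
    linarith [hK n]
  · exact ((integrable_exp_neg_mul_sq hκ).const_mul _).const_mul _
  · refine ae_of_all _ fun v => ?_
    have hmem : ∀ᶠ n : ℕ in atTop, v ∈ Set.Ioc (-(Real.pi * √n)) (Real.pi * √n) := by
      have := (Real.tendsto_sqrt_atTop.comp tendsto_natCast_atTop_atTop).eventually_ge_atTop
        ((|v| + 1) / Real.pi)
      filter_upwards [this] with n hn
      simp only [Function.comp] at hn
      rw [div_le_iff₀ Real.pi_pos] at hn
      constructor <;> cases abs_cases v <;> linarith
    have hcont : Continuous fun p : ℂ => r * exp (p * (v * I)) *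
        genMarkedDeriv (exp (p * s)) (r * exp (p * (v * I))) := by
      unfold genMarkedDeriv genTree genOut genIn
      fun_prop
    have h1 := (hcont.tendsto 0).comp (tendsto_ofReal_inv_sqrt_nat.mono_right nhdsWithin_le_nhds)
    have h2 := (continuous_exp.tendsto _).comp (tendsto_localExponent hr s v)
    have h3 := h1.mul h2
    simp only [zero_mul, exp_zero, mul_one] at h3
    refine h3.congr' ?_
    filter_upwards [hmem] with n hn
    rw [laplaceIntegrand, Set.indicator_of_mem hn]
    rfl

theorem tendsto_forestWeight_ratio {r : ℝ} (hr : IsSaddle r) (s : ℂ) :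
    Tendsto (fun n : ℕ => forestWeight (exp (((√n)⁻¹ : ℝ) * s)) (Finset.univ : Finset (Fin n)) *
      exp (-((√n : ℝ) * saddleMean r * s)) / forestWeight 1 (Finset.univ : Finset (Fin n))) atTop
      (𝓝 (exp (saddleVar r * s ^ 2 / 2))) := by
  set c : ℂ := r * genMarkedDeriv 1 r * (2 * Real.pi / hessRight r : ℂ) ^ (1 / 2 : ℂ) with hc
  have hlim : ∀ s : ℂ, Tendsto (fun n => ∫ v, laplaceIntegrand r n s v) atTop
      (𝓝 (c * exp (saddleVar r * s ^ 2 / 2))) := by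
    intro s
    have := tendsto_integral_laplaceIntegrand hr s
    rwa [integral_const_mul, integral_exp_saddleHess hr.pos, ← mul_assoc, ← hc] at this
  have hc0 : c ≠ 0 := by
    have h1 : (r : ℂ) ≠ 0 := by exact_mod_cast hr.pos.ne'
    have h2 : (2 * Real.pi / hessRight r : ℂ) ≠ 0 := by
      have h3 : (2 * Real.pi / hessRight r : ℝ) ≠ 0 :=
        (div_pos Real.two_pi_pos (hessRight_pos hr.pos)).ne'
      exact_mod_cast h3
    refine mul_ne_zero (mul_ne_zero h1 hr.genMarkedDeriv_ne_zero) ?_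
    rw [Ne, cpow_eq_zero_iff]
    tauto
  have h0 := hlim 0
  simp only [ne_eq, OfNat.ofNat_ne_zero, not_false_eq_true, zero_pow, mul_zero, zero_div, exp_zero,
    mul_one] at h0
  have h := (hlim s).div h0 hc0
  rw [mul_div_cancel_left₀ _ hc0] at h
  refine h.congr' ?_
  filter_upwards [eventually_gt_atTop 0] with n hn
  have hcard : (Finset.univ : Finset (Fin n)).card = n := by simp
  have e1 := forestWeight_eq_laplace (Finset.univ : Finset (Fin n)) hr.pos (by omega) s
  have e2 := forestWeight_eq_laplace (Finset.univ : Finset (Fin n)) hr.pos (by omega) 0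
  rw [hcard] at e1 e2
  rw [mul_zero, mul_zero, exp_zero, mul_one] at e2
  rw [e1, e2]
  have hn0 : (n : ℝ) ≠ 0 := by exact_mod_cast hn.ne'
  have hn0' : (n : ℂ) ≠ 0 := by exact_mod_cast hn.ne'
  have hs : ((√(n : ℝ) : ℝ) : ℂ) ≠ 0 := by
    exact_mod_cast (Real.sqrt_pos.2 (by positivity : (0 : ℝ) < n)).ne'
  have hf : (n.factorial : ℂ) ≠ 0 := by exact_mod_cast n.factorial_ne_zero
  have hr0 : (r : ℂ) ≠ 0 := by exact_mod_cast hr.pos.ne'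
  have hpi : (Real.pi : ℂ) ≠ 0 := by exact_mod_cast Real.pi_ne_zero
  set D : ℂ := n.factorial / (2 * Real.pi * n ^ 2) * ((r : ℂ) ^ n)⁻¹ *
        (((√n)⁻¹ : ℝ) * exp (n * genOut 1 r)) with hD
  have hD0 : D ≠ 0 := by
    rw [hD, ofReal_inv]
    have he := exp_ne_zero (n * genOut 1 r)
    simp only [ne_eq, mul_eq_zero, div_eq_zero_iff, inv_eq_zero, pow_eq_zero_iff', he, hf, hpi, hn0',
      hs, hr0]
    norm_num
  have he : exp ((√n : ℝ) * saddleMean r * s) * exp (-((√n : ℝ) * saddleMean r * s)) = 1 := by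
    rw [← exp_add, add_neg_cancel, exp_zero]
  rw [show D * exp ((√n : ℝ) * saddleMean r * s) * (∫ v, laplaceIntegrand r n s v) *
    exp (-((√n : ℝ) * saddleMean r * s)) = D * (∫ v, laplaceIntegrand r n s v) by
      linear_combination D * (∫ v, laplaceIntegrand r n s v) * he, mul_div_mul_left _ _ hD0,
    Pi.div_apply]

end Laplace

section AnalyticConvergence

open Complex

lemma tendsto_iteratedDeriv_of_bounded {f : ℕ → ℂ → ℂ} {g : ℂ → ℂ} {R B : ℝ} (hR : 0 < R)
    (hf : ∀ n, Differentiable ℂ (f n)) (hg : Differentiable ℂ g)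
    (hB : ∀ n z, ‖z‖ ≤ R → ‖f n z‖ ≤ B)
    (hfg : ∀ z, Tendsto (fun n => f n z) atTop (𝓝 (g z))) (k : ℕ) :
    Tendsto (fun n => iteratedDeriv k (f n) 0) atTop (𝓝 (iteratedDeriv k g 0)) := by
  have key : ∀ h : ℂ → ℂ, Differentiable ℂ h → iteratedDeriv k h 0 =
      (2 * Real.pi * I / k.factorial)⁻¹ * ∮ z in C(0, R), (1 / (z - 0) ^ (k + 1)) • h z := by
    intro h hh
    rw [DiffContOnCl.circleIntegral_one_div_sub_center_pow_smul hR k hh.diffContOnCl, smul_eq_mul,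
      inv_mul_cancel_left₀]
    have hf : (k.factorial : ℂ) ≠ 0 := by exact_mod_cast k.factorial_ne_zero
    have hpi : (Real.pi : ℂ) ≠ 0 := by exact_mod_cast Real.pi_ne_zero
    simp [hf, hpi]
  simp_rw [key _ (hf _), key g hg]
  refine Tendsto.const_mul _ ?_
  refine intervalIntegral.tendsto_integral_filter_of_dominated_convergence
    (fun _ => R * ((1 / R ^ (k + 1)) * B)) ?_ ?_ ?_ ?_
  · refine Eventually.of_forall fun n => Continuous.aestronglyMeasurable ?_
    simp_rw [deriv_circleMap]
    have h1 : Continuous fun θ => (circleMap 0 R θ - 0) ^ (k + 1) := by fun_prop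
    have h2 : Continuous fun θ => f n (circleMap 0 R θ) :=
      (hf n).continuous.comp (continuous_circleMap 0 R)
    refine Continuous.smul ((continuous_circleMap 0 R).mul continuous_const)
      (Continuous.smul (continuous_const.div h1 fun θ => ?_) h2)
    simpa using hR.ne'
  · refine Eventually.of_forall fun n => ae_of_all _ fun θ _ => ?_
    rw [deriv_circleMap, norm_smul, norm_smul, norm_mul, norm_I, mul_one, norm_div, norm_pow,
      norm_one, sub_zero, norm_circleMap_zero, abs_of_pos hR]
    gcongr
    exact hB _ _ (by rw [norm_circleMap_zero, abs_of_pos hR])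
  · exact intervalIntegrable_const
  · exact ae_of_all _ fun θ _ => ((hfg _).const_smul _).const_smul _

end AnalyticConvergence

section UniformLaw

variable {Ω : Type*} [Fintype Ω]

/-- The average of a function over a finite type. -/
noncomputable def average {E : Type*} [DivisionRing E] (f : Ω → E) : E :=
  (∑ ω, f ω) / Fintype.card Ω

/-- The moment generating function of a real function under the uniform law on a finite type. -/
noncomputable def averageExp (W : Ω → ℝ) (s : ℂ) : ℂ := average fun ω => Complex.exp (W ω * s)

lemma hasDerivAt_average_pow_mul_exp (W : Ω → ℝ) (k : ℕ) (s : ℂ) :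
    HasDerivAt (fun s => average fun ω => (W ω : ℂ) ^ k * Complex.exp (W ω * s))
      (average fun ω => (W ω : ℂ) ^ (k + 1) * Complex.exp (W ω * s)) s := by
  refine (HasDerivAt.fun_sum fun ω _ => ?_).div_const _
  refine ((hasDerivAt_const_mul (W ω : ℂ)).cexp.const_mul _).congr_deriv ?_
  ring

lemma iteratedDeriv_averageExp (W : Ω → ℝ) (k : ℕ) :
    iteratedDeriv k (averageExp W) =
      fun s => average fun ω => (W ω : ℂ) ^ k * Complex.exp (W ω * s) := by
  induction k with
  | zero =>
    ext s
    simp [averageExp]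
  | succ k ih =>
    rw [iteratedDeriv_succ, ih]
    exact funext fun s => (hasDerivAt_average_pow_mul_exp W k s).deriv

lemma differentiable_averageExp (W : Ω → ℝ) : Differentiable ℂ (averageExp W) := by
  intro s
  have := (hasDerivAt_average_pow_mul_exp W 0 s).differentiableAt
  simp only [pow_zero, one_mul] at this
  exact this

lemma ofReal_average (f : Ω → ℝ) : ((average f : ℝ) : ℂ) = average fun ω => (f ω : ℂ) := by
  simp [average]

lemma iteratedDeriv_averageExp_zero (W : Ω → ℝ) (k : ℕ) :
    iteratedDeriv k (averageExp W) 0 = ((average fun ω => W ω ^ k : ℝ) : ℂ) := by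
  rw [iteratedDeriv_averageExp, ofReal_average]
  simp

lemma norm_averageExp_le (W : Ω → ℝ) {s : ℂ} (hs : ‖s‖ ≤ 1) :
    ‖averageExp W s‖ ≤ ‖averageExp W 1‖ + ‖averageExp W (-1)‖ := by
  have h1 : ∀ t : ℝ, averageExp W t = ((average fun ω => Real.exp (W ω * t) : ℝ) : ℂ) := by
    intro t
    rw [averageExp, ofReal_average]
    push_cast
    rfl
  have h2 : ∀ t : ℝ, ‖averageExp W t‖ = average fun ω => Real.exp (W ω * t) := by
    intro t
    rw [h1, Complex.norm_real, Real.norm_of_nonneg]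
    unfold average
    positivity
  have e1 := h2 1
  have e2 := h2 (-1)
  push_cast at e1 e2
  rw [e1, e2, average, average, ← add_div, ← Finset.sum_add_distrib, averageExp, average, norm_div,
    Complex.norm_natCast]
  gcongr
  refine (norm_sum_le _ _).trans (Finset.sum_le_sum fun ω _ => ?_)
  rw [Complex.norm_exp, Complex.re_ofReal_mul]
  have hre := abs_le.1 ((Complex.abs_re_le_norm s).trans hs)
  rcases le_total 0 (W ω) with h | h
  · have : Real.exp (W ω * s.re) ≤ Real.exp (W ω * 1) := Real.exp_le_exp.2 (by nlinarith)
    linarith [Real.exp_pos (W ω * -1)]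
  · have : Real.exp (W ω * s.re) ≤ Real.exp (W ω * -1) := Real.exp_le_exp.2 (by nlinarith)
    linarith [Real.exp_pos (W ω * 1)]

/-- The law of a real function under the uniform law on a finite type. -/
noncomputable def uniformLaw (W : Ω → ℝ) : Measure ℝ :=
  (Fintype.card Ω : ENNReal)⁻¹ • ∑ ω, Measure.dirac (W ω)

instance [Nonempty Ω] (W : Ω → ℝ) : IsProbabilityMeasure (uniformLaw W) := by
  refine ⟨?_⟩
  simp only [uniformLaw, Measure.smul_apply, Measure.finsetSum_apply, measure_univ,
    Finset.sum_const, Finset.card_univ, smul_eq_mul, nsmul_eq_mul, mul_one]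
  exact ENNReal.inv_mul_cancel (by simp) (by simp)

lemma charFun_uniformLaw (W : Ω → ℝ) (t : ℝ) :
    charFun (uniformLaw W) t = averageExp W (t * Complex.I) := by
  rw [charFun_apply_real, uniformLaw, integral_smul_measure, integral_finsetSum_measure]
  · simp only [integral_dirac, averageExp, average]
    rw [ENNReal.toReal_inv, ENNReal.toReal_natCast, Complex.real_smul, div_eq_inv_mul]
    push_cast
    congr 1
    refine Finset.sum_congr rfl fun ω _ => ?_
    congr 1
    ring
  · intro ω _
    exact integrable_dirac (by simp)

lemma uniformLaw_real_Iic (W : Ω → ℝ) (y : ℝ) :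
    (uniformLaw W).real (Set.Iic y) =
      (Nat.card {ω // W ω ≤ y} : ℝ) / Fintype.card Ω := by
  classical
  rw [Measure.real, uniformLaw, Measure.smul_apply, Measure.finsetSum_apply, smul_eq_mul,
    ENNReal.toReal_mul, ENNReal.toReal_inv, ENNReal.toReal_natCast, div_eq_inv_mul]
  congr 1
  simp only [measurableSet_Iic, Measure.dirac_apply', Set.indicator_apply, Set.mem_Iic,
    Pi.one_apply]
  rw [Finset.sum_boole, ENNReal.toReal_natCast, Nat.card_eq_fintype_card, Fintype.card_subtype]

end UniformLaw

section NormalCDF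

open ProbabilityTheory

lemma gaussianReal_real_Iic (x : ℝ) : (gaussianReal 0 1).real (Set.Iic x) =
    (√(2 * Real.pi))⁻¹ * ∫ t in Set.Iic x, Real.exp (-(t ^ 2) / 2) := by
  rw [Measure.real, gaussianReal_apply_eq_integral 0 one_ne_zero, ENNReal.toReal_ofReal
    (setIntegral_nonneg measurableSet_Iic fun t _ => gaussianPDFReal_nonneg _ _ _)]
  simp only [gaussianPDFReal_def, sub_zero, NNReal.coe_one, mul_one]
  rw [integral_const_mul]

lemma continuous_gaussianReal_real_Iic :
    Continuous fun x => (gaussianReal 0 1).real (Set.Iic x) := by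
  have h1 : ∀ x, (gaussianReal 0 1).real (Set.Iic x) = (gaussianReal 0 1).real (Set.Iic 0) +
      ∫ t in (0 : ℝ)..x, gaussianPDFReal 0 1 t := by
    have h : ∀ x, (gaussianReal 0 1).real (Set.Iic x) =
        ∫ t in Set.Iic x, gaussianPDFReal 0 1 t := fun x => by
      rw [Measure.real, gaussianReal_apply_eq_integral 0 one_ne_zero, ENNReal.toReal_ofReal
        (setIntegral_nonneg measurableSet_Iic fun t _ => gaussianPDFReal_nonneg _ _ _)]
    intro x
    have hi := integrable_gaussianPDFReal 0 1
    rw [h, h, ← intervalIntegral.integral_Iic_sub_Iic hi.integrableOn hi.integrableOn]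
    ring
  rw [funext h1]
  exact continuous_const.add (intervalIntegral.continuous_primitive
    (fun a b => (integrable_gaussianPDFReal 0 1).intervalIntegrable) 0)

lemma tendsto_apply_of_monotone {F : ℕ → ℝ → ℝ} {Φ : ℝ → ℝ} {y : ℕ → ℝ} {x : ℝ}
    (hF : ∀ n, Monotone (F n)) (hΦ : Continuous Φ)
    (hlim : ∀ t, Tendsto (fun n => F n t) atTop (𝓝 (Φ t))) (hy : Tendsto y atTop (𝓝 x)) :
    Tendsto (fun n => F n (y n)) atTop (𝓝 (Φ x)) := by
  refine tendsto_order.2 ⟨fun a ha => ?_, fun a ha => ?_⟩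
  · obtain ⟨t, ht, htx⟩ := (((hΦ.tendsto x).mono_left
      (nhdsWithin_le_nhds (s := Set.Iio x))).eventually_const_lt ha).and
        self_mem_nhdsWithin |>.exists
    filter_upwards [(hlim t).eventually_const_lt ht, hy.eventually_const_lt htx] with n h1 h2
    exact h1.trans_le (hF n h2.le)
  · obtain ⟨t, ht, htx⟩ := (((hΦ.tendsto x).mono_left
      (nhdsWithin_le_nhds (s := Set.Ioi x))).eventually_lt_const ha).and
        self_mem_nhdsWithin |>.exists
    filter_upwards [(hlim t).eventually_lt_const ht, hy.eventually_lt_const htx] with n h1 h2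
    exact (hF n h2.le).trans_lt h1

/-- If the moment generating functions of a sequence of random variables, each defined on a finite
type with the uniform law, converge on the complex plane to that of the standard normal law, then
the standardized random variables satisfy a central limit theorem. -/
theorem tendsto_card_le_of_tendsto_averageExp {Ω : ℕ → Type*} [∀ n, Fintype (Ω n)]
    [∀ n, Nonempty (Ω n)] (W : ∀ n, Ω n → ℝ)
    (h : ∀ s : ℂ, Tendsto (fun n => averageExp (W n) s) atTop (𝓝 (Complex.exp (s ^ 2 / 2))))
    (x : ℝ) :
    Tendsto (fun n => (Nat.card {ω // W n ω ≤ average (W n) +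
        x * √(average (fun ω => W n ω ^ 2) - average (W n) ^ 2)} : ℝ) / Fintype.card (Ω n)) atTop
      (𝓝 ((√(2 * Real.pi))⁻¹ * ∫ t in Set.Iic x, Real.exp (-(t ^ 2) / 2))) := by
  obtain ⟨B, hB⟩ : ∃ B, ∀ n z, ‖z‖ ≤ 1 → ‖averageExp (W n) z‖ ≤ B := by
    obtain ⟨B, hB⟩ := ((h 1).norm.add (h (-1)).norm).bddAbove_range
    exact ⟨B, fun n z hz => (norm_averageExp_le _ hz).trans (hB ⟨n, rfl⟩)⟩
  have hg : Differentiable ℂ fun s : ℂ => Complex.exp (s ^ 2 / 2) := by fun_prop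
  have hmom := tendsto_iteratedDeriv_of_bounded one_pos (fun n => differentiable_averageExp (W n))
    hg hB h
  simp_rw [iteratedDeriv_averageExp_zero] at hmom
  have hd1 : ∀ s : ℂ, HasDerivAt (fun s : ℂ => Complex.exp (s ^ 2 / 2))
      (s * Complex.exp (s ^ 2 / 2)) s := by
    intro s
    refine (((hasDerivAt_pow 2 s).div_const 2).cexp).congr_deriv ?_
    push_cast
    ring
  have hd : deriv (fun s : ℂ => Complex.exp (s ^ 2 / 2)) = fun s => s * Complex.exp (s ^ 2 / 2) :=
    funext fun s => (hd1 s).deriv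
  have hm : Tendsto (fun n => average (W n)) atTop (𝓝 0) := by
    have := (Complex.continuous_re.tendsto _).comp (hmom 1)
    rw [iteratedDeriv_one, hd] at this
    simpa [Function.comp_def] using this
  have hv : Tendsto (fun n => average fun ω => W n ω ^ 2) atTop (𝓝 1) := by
    have := (Complex.continuous_re.tendsto _).comp (hmom 2)
    rw [iteratedDeriv_succ, iteratedDeriv_one, hd,
      ((hasDerivAt_id' (0 : ℂ)).fun_mul (hd1 0)).deriv] at this
    simpa [Function.comp_def] using this
  have hy : Tendsto (fun n => average (W n) +
      x * √(average (fun ω => W n ω ^ 2) - average (W n) ^ 2)) atTop (𝓝 x) := by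
    have := hm.add ((hv.sub (hm.pow 2)).sqrt.const_mul x)
    simpa using this
  let P : ℕ → ProbabilityMeasure ℝ := fun n => ⟨uniformLaw (W n), inferInstance⟩
  let P₀ : ProbabilityMeasure ℝ := ⟨gaussianReal 0 1, inferInstance⟩
  have hP : Tendsto P atTop (𝓝 P₀) := by
    refine ProbabilityMeasure.tendsto_iff_tendsto_charFun.2 fun t => ?_
    change Tendsto (fun n => charFun (uniformLaw (W n)) t) atTop
      (𝓝 (charFun (gaussianReal 0 1) t))
    simp_rw [charFun_uniformLaw]
    rw [charFun_gaussianReal]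
    convert h (t * Complex.I) using 3
    rw [mul_pow, Complex.I_sq]
    push_cast
    ring
  have hcdf : ∀ t, Tendsto (fun n => (uniformLaw (W n)).real (Set.Iic t)) atTop
      (𝓝 ((gaussianReal 0 1).real (Set.Iic t))) := by
    intro t
    have hnull : NullSingletonClass (gaussianReal 0 1) :=
      nullSingletonClass_gaussianReal one_ne_zero
    have := ProbabilityMeasure.tendsto_measure_of_null_frontier_of_tendsto' hP (E := Set.Iic t) (by
      rw [frontier_Iic]
      exact measure_singleton (μ := gaussianReal 0 1) t)
    exact (ENNReal.tendsto_toReal (measure_ne_top _ _)).comp this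
  rw [← gaussianReal_real_Iic]
  simp_rw [← uniformLaw_real_Iic]
  exact tendsto_apply_of_monotone (F := fun n t => (uniformLaw (W n)).real (Set.Iic t))
    (fun n a b hab => measureReal_mono (Set.Iic_subset_Iic.2 hab))
    continuous_gaussianReal_real_Iic hcdf hy

end NormalCDF

section MaximalIndependentSets

lemma isMaximalIndepSet_iff {V : Type*} (G : SimpleGraph V) (J : Set V) :
    IsMaximalIndepSet G J ↔ IsIndepSet G J ∧ ∀ v ∉ J, ∃ w ∈ J, G.Adj v w := by
  refine and_congr_right fun hJ => ⟨fun h v hv => ?_, fun h J' hJ' hss => ?_⟩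
  · by_contra! hw
    refine h (insert v J) ?_ (Set.ssubset_insert hv)
    rintro a b (rfl | ha) (rfl | hb)
    · exact G.loopless.irrefl _
    · exact hw b hb
    · exact fun hab => hw a ha hab.symm
    · exact hJ ha hb
  · obtain ⟨v, hv', hv⟩ := Set.exists_of_ssubset hss
    obtain ⟨w, hw, hvw⟩ := h v hv
    exact hJ' hv' (hss.1 hw) hvw

lemma forestPair_univ_iff {V : Type*} [Fintype V] (G : SimpleGraph V) (J : Finset V) :
    ForestPair G Finset.univ J ↔ G.IsAcyclic ∧ IsMaximalIndepSet G J := by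
  rw [isMaximalIndepSet_iff]
  simp only [ForestPair, IsForestOn, SupportedOn, IndepIn, IsIndepSet, Dominated]
  aesop

noncomputable instance (n : ℕ) : Fintype (MISpace n) := by
  classical exact inferInstanceAs (Fintype {p : SimpleGraph (Fin n) × Set (Fin n) //
    p.1.IsAcyclic ∧ IsMaximalIndepSet p.1 p.2})

instance (n : ℕ) : Nonempty (MISpace n) := by
  refine ⟨⟨(⊥, Set.univ), SimpleGraph.isAcyclic_bot, fun _ _ _ _ => id, fun J _ hss => ?_⟩⟩
  exact hss.2 (Set.subset_univ _)

/-- Pairs of a forest on `Fin n` and a maximal independent set, described by finite sets. -/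
noncomputable def miSpaceEquiv (n : ℕ) :
    MISpace n ≃ {x : SimpleGraph (Fin n) × Finset (Fin n) // ForestPair x.1 Finset.univ x.2} :=
  (((Equiv.refl _).prodCongr Fintype.finsetEquivSet).subtypeEquiv
    fun x => forestPair_univ_iff x.1 x.2).symm

lemma card_miSpaceEquiv {n : ℕ} (p : MISpace n) :
    (miSpaceEquiv n p).val.2.card = p.val.2.ncard := by
  obtain ⟨q, rfl⟩ := (miSpaceEquiv n).symm.surjective p
  rw [Equiv.apply_symm_apply]
  exact (Set.ncard_coe_finset q.val.2).symm

lemma forestWeight_univ_eq_sum (n : ℕ) (u : ℂ) :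
    forestWeight u (Finset.univ : Finset (Fin n)) = ∑ p : MISpace n, u ^ p.val.2.ncard := by
  classical
  rw [forestWeight, Finset.sum_subtype (p := fun x : SimpleGraph (Fin n) × Finset (Fin n) =>
    ForestPair x.1 Finset.univ x.2) _ (fun x => by simp)]
  exact (Fintype.sum_equiv (miSpaceEquiv n) _ _ fun p => by rw [card_miSpaceEquiv]).symm

end MaximalIndependentSets

section Standardization

variable {Ω : Type*} [Fintype Ω] [Nonempty Ω]

lemma average_affine (X : Ω → ℝ) (a b : ℝ) :
    average (fun ω => a * (X ω - b)) = a * (average X - b) := by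
  have : (Fintype.card Ω : ℝ) ≠ 0 := by simp
  simp only [average, ← Finset.mul_sum, Finset.sum_sub_distrib, Finset.sum_const,
    Finset.card_univ, nsmul_eq_mul]
  field_simp

lemma variance_affine (X : Ω → ℝ) (a b : ℝ) :
    average (fun ω => (a * (X ω - b)) ^ 2) - average (fun ω => a * (X ω - b)) ^ 2 =
      a ^ 2 * (average (fun ω => X ω ^ 2) - average X ^ 2) := by
  have : (Fintype.card Ω : ℝ) ≠ 0 := by simp
  have e : ∀ ω, (a * (X ω - b)) ^ 2 = a ^ 2 * X ω ^ 2 - 2 * a ^ 2 * b * X ω + a ^ 2 * b ^ 2 := by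
    intro ω
    ring
  rw [average_affine]
  simp only [average, e, Finset.sum_add_distrib, ← Finset.mul_sum, Finset.sum_sub_distrib,
    Finset.sum_const, Finset.card_univ, nsmul_eq_mul]
  field_simp
  ring

lemma affine_le_iff (X : Ω → ℝ) {a : ℝ} (ha : 0 < a) (b x : ℝ) (ω : Ω) :
    a * (X ω - b) ≤ average (fun ω => a * (X ω - b)) + x *
      √(average (fun ω => (a * (X ω - b)) ^ 2) - average (fun ω => a * (X ω - b)) ^ 2) ↔
    X ω ≤ average X + x * √(average (fun ω => X ω ^ 2) - average X ^ 2) := by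
  rw [variance_affine, average_affine, Real.sqrt_mul (by positivity), Real.sqrt_sq ha.le]
  refine ⟨fun h => le_of_mul_le_mul_left ?_ ha, fun h => ?_⟩
  · linarith
  · have := mul_le_mul_of_nonneg_left h ha.le
    linarith

end Standardization

lemma averageExp_ncard (n : ℕ) (a b : ℝ) (s : ℂ) :
    averageExp (fun p : MISpace n => a * ((p.val.2.ncard : ℝ) - b)) s =
      forestWeight (Complex.exp (a * s)) (Finset.univ : Finset (Fin n)) *
        Complex.exp (-(a * b * s)) / forestWeight 1 (Finset.univ : Finset (Fin n)) := by
  rw [forestWeight_univ_eq_sum, forestWeight_univ_eq_sum, averageExp, average, Finset.sum_mul]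
  congr 1
  · refine Finset.sum_congr rfl fun p _ => ?_
    rw [← Complex.exp_nat_mul, ← Complex.exp_add]
    congr 1
    push_cast
    ring
  · simp

end ForestMIS

theorem stmt_14 :
    ∀ x : ℝ,
      Tendsto
        (fun n : ℕ =>
          (Nat.card {p : MISpace n //
              (p.val.2.ncard : ℝ) ≤ En n + x * Real.sqrt (Vn n)} : ℝ) / (iN n : ℝ))
        atTop
        (nhds ((Real.sqrt (2 * Real.pi))⁻¹ *
          ∫ t in Set.Iic x, Real.exp (-(t ^ 2) / 2))) := by
  intro x
  obtain ⟨r, hr⟩ := ForestMIS.exists_isSaddle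
  have hσ := Real.sqrt_pos.2 (ForestMIS.saddleVar_pos hr.pos)
  set σ := √(ForestMIS.saddleVar r)
  have hσ2 : σ ^ 2 = ForestMIS.saddleVar r := Real.sq_sqrt (ForestMIS.saddleVar_pos hr.pos).le
  have key := ForestMIS.tendsto_card_le_of_tendsto_averageExp
    (fun n (p : MISpace n) => (√n)⁻¹ * σ⁻¹ * ((p.val.2.ncard : ℝ) - n * ForestMIS.saddleMean r))
    (fun s => ?_) x
  · refine key.congr' ?_
    filter_upwards [eventually_gt_atTop 0] with n hn
    have hn0 : 0 < √(n : ℝ) := Real.sqrt_pos.2 (by exact_mod_cast hn)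
    simp_rw [ForestMIS.affine_le_iff (fun p : MISpace n => (p.val.2.ncard : ℝ))
      (by positivity : 0 < (√(n : ℝ))⁻¹ * σ⁻¹)]
    simp only [ForestMIS.average, En, Vn, iN, finsum_eq_sum_of_fintype, Nat.card_eq_fintype_card]
  · have h := ForestMIS.tendsto_forestWeight_ratio hr (s / σ)
    have hσ0 : (σ : ℂ) ≠ 0 := by exact_mod_cast hσ.ne'
    have e : (ForestMIS.saddleVar r : ℂ) * (s / σ) ^ 2 / 2 = s ^ 2 / 2 := by
      rw [← hσ2]
      push_cast
      field_simp
    rw [e] at h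
    refine h.congr' ?_
    filter_upwards [eventually_gt_atTop 0] with n hn
    have hn0 : 0 < √(n : ℝ) := Real.sqrt_pos.2 (by exact_mod_cast hn)
    have h1 : ((√(n : ℝ) : ℝ) : ℂ) ≠ 0 := by exact_mod_cast hn0.ne'
    have h2 : (n : ℂ) = ((√(n : ℝ) : ℝ) : ℂ) ^ 2 := by
      rw [← Complex.ofReal_pow, Real.sq_sqrt (by positivity), Complex.ofReal_natCast]
    rw [ForestMIS.averageExp_ncard]
    congr 3
    · congr 1
      push_cast
      ring
    · push_cast
      rw [h2]
      field_simp
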